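/- Let N ⊆ M be hyperfinite II₁ factors with N' ∩ M = ℂ1, let ω be a free ultrafilter on ℕ, and suppose M' ∩ M^ω ⊆ N^ω. Then (M' ∩ M^ω)' ∩ M^ω = M, (N' ∩ N^ω)' ∩ M^ω = N, and (M' ∩ M^ω)' ∩ (N' ∩ M^ω) = ℂ1. -/

import Mathlib

open scoped ComplexOrder
open Filter

namespace PopaQ

variable {H : Type u} [NormedAddCommGroup H] [InnerProductSpace ℂ H] [CompleteSpace H]

/-- Bounded operators on `H`. -/
abbrev Op (H : Type u) [NormedAddCommGroup H] [InnerProductSpace ℂ H] [CompleteSpace H] :=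
  H →L[ℂ] H

/-- The relative commutant `N' ∩ M` (as sets of operators). -/
def relComm (N M : Set (Op H)) : Set (Op H) :=
  {x | x ∈ M ∧ ∀ y ∈ N, y * x = x * y}

/-- The scalar operators `ℂ 1`. -/
def scalars (H : Type u) [NormedAddCommGroup H] [InnerProductSpace ℂ H] [CompleteSpace H] :
    Set (Op H) :=
  {x | ∃ c : ℂ, x = c • (1 : Op H)}

/-- A (self-adjoint) projection. -/
def IsProjection (p : Op H) : Prop :=
  IsSelfAdjoint p ∧ IsIdempotentElem p

/-- `τ` is a faithful tracial state on `M`. -/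
structure IsTracialState (M : Set (Op H)) (τ : Op H →ₗ[ℂ] ℂ) : Prop where
  map_one : τ 1 = 1
  tracial : ∀ x ∈ M, ∀ y ∈ M, τ (x * y) = τ (y * x)
  pos : ∀ x ∈ M, 0 ≤ τ (star x * x)
  faithful : ∀ x ∈ M, τ (star x * x) = 0 → x = 0

/-- A set of operators is finite dimensional as a complex vector space. -/
def FinDim (S : Set (Op H)) : Prop :=
  ∃ s : Finset (Op H), S ⊆ (Submodule.span ℂ (s : Set (Op H)) : Set (Op H))

/-- `M` is a II₁ factor with faithful normal trace `τ`:
a factor (trivial center) carrying a faithful tracial state, which is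
infinite dimensional. -/
structure IsII1Factor (M : VonNeumannAlgebra H) (τ : Op H →ₗ[ℂ] ℂ) : Prop where
  factor : relComm (M : Set (Op H)) (M : Set (Op H)) = scalars H
  trace : IsTracialState (M : Set (Op H)) τ
  infdim : ¬ FinDim (M : Set (Op H))

/-- `M` is hyperfinite: it is the (weak closure = double commutant) of an increasing
union of finite-dimensional *-subalgebras. -/
def IsHyperfinite (M : VonNeumannAlgebra H) : Prop :=
  ∃ A : ℕ → StarSubalgebra ℂ (Op H),
    Monotone A ∧ (∀ n, (A n : Set (Op H)) ⊆ M) ∧ (∀ n, FinDim (A n : Set (Op H))) ∧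
    Set.centralizer (Set.centralizer (⋃ n, (A n : Set (Op H)))) = (M : Set (Op H))

/-- A bounded sequence of operators. -/
def Bdd (x : ℕ → Op H) : Prop :=
  ∃ C : ℝ, ∀ n, ‖x n‖ ≤ C

/-- A sequence taking values in `S`. -/
def SeqIn (S : Set (Op H)) (x : ℕ → Op H) : Prop :=
  ∀ n, x n ∈ S

/-- A free ultrafilter on ℕ. -/
def IsFreeUltrafilter (ω : Ultrafilter ℕ) : Prop :=
  ∀ s : Set ℕ, s.Finite → s ∉ ω

/-- `Mω` is the tracial ultrapower of `M` along `ω`, with trace `τ`;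
`limω` assigns to each bounded sequence in `M` its class in `Mω` (the diagonal
embedding of `M` into `Mω` being the identity on `M`). -/
structure IsTracialUltrapower (ω : Ultrafilter ℕ) (M Mω : VonNeumannAlgebra H)
    (τ : Op H →ₗ[ℂ] ℂ) (limω : (ℕ → Op H) → Op H) : Prop where
  subset : (M : Set (Op H)) ⊆ (Mω : Set (Op H))
  mem : ∀ x, SeqIn (M : Set (Op H)) x → Bdd x → limω x ∈ Mω
  diag : ∀ m ∈ M, limω (fun _ => m) = m
  map_add : ∀ x y, SeqIn (M : Set (Op H)) x → Bdd x → SeqIn (M : Set (Op H)) y → Bdd y →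
    limω (fun n => x n + y n) = limω x + limω y
  map_mul : ∀ x y, SeqIn (M : Set (Op H)) x → Bdd x → SeqIn (M : Set (Op H)) y → Bdd y →
    limω (fun n => x n * y n) = limω x * limω y
  map_smul : ∀ (c : ℂ) x, SeqIn (M : Set (Op H)) x → Bdd x →
    limω (fun n => c • x n) = c • limω x
  map_star : ∀ x, SeqIn (M : Set (Op H)) x → Bdd x →
    limω (fun n => star (x n)) = star (limω x)
  surj : ∀ z ∈ Mω, ∃ x, SeqIn (M : Set (Op H)) x ∧ Bdd x ∧ limω x = z
  tr : ∀ x, SeqIn (M : Set (Op H)) x → Bdd x →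
    Tendsto (fun n => τ (x n)) (ω : Filter ℕ) (nhds (τ (limω x)))
  eq_zero : ∀ x, SeqIn (M : Set (Op H)) x → Bdd x →
    (limω x = 0 ↔ Tendsto (fun n => ‖τ (star (x n) * x n)‖) (ω : Filter ℕ) (nhds 0))
  traceState : IsTracialState (Mω : Set (Op H)) τ

/-- The ultrapower `N^ω ⊆ M^ω` of a subalgebra `N ⊆ M`: classes of bounded
sequences with entries in `N`. -/
def ultrapowerSet (limω : (ℕ → Op H) → Op H) (N : Set (Op H)) : Set (Op H) :=
  {z | ∃ x, SeqIn N x ∧ Bdd x ∧ limω x = z}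

/-- `θ` is a *-homomorphism from `S` to `T` (as sets of operators). -/
def IsStarHomOn (θ : Op H → Op H) (S T : Set (Op H)) : Prop :=
  (∀ x ∈ S, θ x ∈ T) ∧
  (∀ x ∈ S, ∀ y ∈ S, θ (x + y) = θ x + θ y) ∧
  (∀ x ∈ S, ∀ y ∈ S, θ (x * y) = θ x * θ y) ∧
  (∀ (c : ℂ), ∀ x ∈ S, θ (c • x) = c • θ x) ∧
  (∀ x ∈ S, θ (star x) = star (θ x))

/-- The corner `p S p` of a set of operators. -/
def corner (p : Op H) (S : Set (Op H)) : Set (Op H) :=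
  {x | x ∈ S ∧ p * x * p = x}

/-- Popa's intertwining relation: a corner of `P` embeds into `Q` inside `M`,
written `P ≺_M Q`: there are nonzero projections `p ∈ P`, `q ∈ Q`, a
*-homomorphism `θ : pPp → qQq` and a nonzero partial isometry `v ∈ qMp` with
`θ(x) v = v x` for all `x ∈ pPp`. -/
def CornerEmbeds (P Q M : Set (Op H)) : Prop :=
  ∃ (p q v : Op H) (θ : Op H → Op H),
    p ∈ P ∧ IsProjection p ∧ p ≠ 0 ∧
    q ∈ Q ∧ IsProjection q ∧ q ≠ 0 ∧
    IsStarHomOn θ (corner p P) (corner q Q) ∧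
    v ∈ M ∧ v ≠ 0 ∧ IsProjection (star v * v) ∧ q * v * p = v ∧
    ∀ x ∈ corner p P, θ x * v = v * x

/-- `E` is the (`τ`-preserving) conditional expectation from `M` onto `Q`. -/
structure IsCondExp (τ : Op H →ₗ[ℂ] ℂ) (M Q : Set (Op H)) (E : Op H → Op H) : Prop where
  mem : ∀ x ∈ M, E x ∈ Q
  fix : ∀ q ∈ Q, E q = q
  map_add : ∀ x ∈ M, ∀ y ∈ M, E (x + y) = E x + E y
  map_smul : ∀ (c : ℂ), ∀ x ∈ M, E (c • x) = c • E x
  bimod : ∀ a ∈ Q, ∀ x ∈ M, ∀ b ∈ Q, E (a * x * b) = a * E x * b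
  tr : ∀ x ∈ M, τ (E x) = τ x

/-- `c` is a Pimsner–Popa bound for the inclusion `Q ⊆ M` with conditional
expectation `E`: every positive `x ∈ M` satisfies `x ≤ c E(x)`. -/
def IndexBound (M : Set (Op H)) (E : Op H → Op H) (c : ℝ) : Prop :=
  ∀ x ∈ M, x.IsPositive → (c • E x - x).IsPositive

/-- The inclusion `Q ⊆ M` (with conditional expectation `E`) has finite Jones index. -/
def HasFiniteIndex (M : Set (Op H)) (E : Op H → Op H) : Prop :=
  ∃ c : ℝ, 0 < c ∧ IndexBound M E c

/-- The Jones index `[M : Q]` of an inclusion `Q ⊆ M` with conditional expectation `E`,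
via the Pimsner–Popa characterization as the optimal constant `c` with
`x ≤ c E(x)` for all positive `x ∈ M`. -/
noncomputable def jonesIndex (M : Set (Op H)) (E : Op H → Op H) : ℝ :=
  sInf {c : ℝ | 0 < c ∧ IndexBound M E c}

section part1
/-- squared 2-norm -/
noncomputable def q (τ : Op H →ₗ[ℂ] ℂ) (x : Op H) : ℝ := (τ (star x * x)).re

lemma vsmul {W : VonNeumannAlgebra H} (c : ℂ) {x : Op H} (hx : x ∈ W) : c • x ∈ W :=
  W.toStarSubalgebra.smul_mem hx c

lemma vrsmul {W : VonNeumannAlgebra H} (c : ℝ) {x : Op H} (hx : x ∈ W) : c • x ∈ W := by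
  have := vsmul (c : ℂ) hx
  simpa using this

lemma mem_of_comm {W : VonNeumannAlgebra H} {x : Op H}
    (h : ∀ T : Op H, (∀ a ∈ W, a * T = T * a) → T * x = x * T) : x ∈ W := by
  have h1 : x ∈ Set.centralizer (Set.centralizer (W : Set (Op H))) := by
    intro T hT
    exact h T (fun a ha => hT a ha)
  rw [VonNeumannAlgebra.centralizer_centralizer] at h1
  exact h1

lemma sqrt_mem {W : VonNeumannAlgebra H} {p : Op H} (hp : p ∈ W) : CFC.sqrt p ∈ W := by
  apply mem_of_comm
  intro T hT
  have : Commute p T := hT p hp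
  exact (this.cfcₙ_nnreal _).symm

lemma exists_sqrt {W : VonNeumannAlgebra H} {p : Op H} (hp : p ∈ W) (h0 : 0 ≤ p) :
    ∃ b ∈ W, p = star b * b := by
  refine ⟨CFC.sqrt p, sqrt_mem hp, ?_⟩
  have h1 : star (CFC.sqrt p) = CFC.sqrt p := (CFC.sqrt_nonneg p).isSelfAdjoint
  rw [h1, CFC.sqrt_mul_sqrt_self p h0]

variable {W : VonNeumannAlgebra H} {τ : Op H →ₗ[ℂ] ℂ}

lemma tau_nonneg (hτ : IsTracialState (W : Set (Op H)) τ) {p : Op H} (hp : p ∈ W) (h0 : 0 ≤ p) :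
    0 ≤ (τ p).re := by
  obtain ⟨b, hb, rfl⟩ := exists_sqrt hp h0
  exact (Complex.le_def.1 (hτ.pos b hb)).1

lemma tau_eq_q (hτ : IsTracialState (W : Set (Op H)) τ) {x : Op H} (hx : x ∈ W) :
    τ (star x * x) = (q τ x : ℂ) := by
  apply Complex.ext
  · simp [q]
  · have := (Complex.le_def.1 (hτ.pos x hx)).2
    simpa using this.symm

lemma tau_mono (hτ : IsTracialState (W : Set (Op H)) τ) {a b : Op H} (ha : a ∈ W) (hb : b ∈ W)
    (h : a ≤ b) : (τ a).re ≤ (τ b).re := by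
  have := tau_nonneg hτ (sub_mem hb ha) (sub_nonneg.2 h)
  simpa using this

lemma tau_zero (hτ : IsTracialState (W : Set (Op H)) τ) {p : Op H} (hp : p ∈ W) (h0 : 0 ≤ p)
    (h : (τ p).re ≤ 0) : p = 0 := by
  obtain ⟨b, hb, rfl⟩ := exists_sqrt hp h0
  have h2 := hτ.pos b hb
  have : b = 0 := hτ.faithful b hb (by
    apply le_antisymm _ h2
    rw [Complex.le_def] at h2 ⊢
    exact ⟨h, h2.2.symm⟩)
  simp [this]

lemma q_nonneg (hτ : IsTracialState (W : Set (Op H)) τ) {x : Op H} (hx : x ∈ W) : 0 ≤ q τ x :=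
  (Complex.le_def.1 (hτ.pos x hx)).1

lemma q_zero (hτ : IsTracialState (W : Set (Op H)) τ) {x : Op H} (hx : x ∈ W) (h : q τ x ≤ 0) :
    x = 0 := by
  apply hτ.faithful x hx
  rw [tau_eq_q hτ hx, le_antisymm h (q_nonneg hτ hx)]; simp

lemma q_para (x y : Op H) : q τ (x + y) + q τ (x - y) = 2 * q τ x + 2 * q τ y := by
  unfold q
  rw [← Complex.add_re, ← map_add]
  have : star (x + y) * (x + y) + star (x - y) * (x - y)
    = (star x * x + star x * x) + (star y * y + star y * y) := by
    simp only [star_add, star_sub]; noncomm_ring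
  rw [this]; simp; ring

lemma q_add_le (hτ : IsTracialState (W : Set (Op H)) τ) {x y : Op H} (hx : x ∈ W) (hy : y ∈ W) :
    q τ (x + y) ≤ 2 * q τ x + 2 * q τ y := by
  have := q_para (τ := τ) x y
  have := q_nonneg hτ (sub_mem hx hy)
  linarith

lemma q_neg (x : Op H) : q τ (-x) = q τ x := by simp [q]

lemma q_sub_comm (x y : Op H) : q τ (x - y) = q τ (y - x) := by rw [← q_neg, neg_sub]

lemma q_sub_le (hτ : IsTracialState (W : Set (Op H)) τ) {x y : Op H} (hx : x ∈ W) (hy : y ∈ W) :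
    q τ (x - y) ≤ 2 * q τ x + 2 * q τ y := by
  have := q_para (τ := τ) x y
  have := q_nonneg hτ (add_mem hx hy)
  linarith

lemma q_tri (hτ : IsTracialState (W : Set (Op H)) τ) {x y z : Op H} (hx : x ∈ W) (hy : y ∈ W)
    (hz : z ∈ W) :
    q τ (x - z) ≤ 2 * q τ (x - y) + 2 * q τ (y - z) := by
  have := q_add_le hτ (sub_mem hx hy) (sub_mem hy hz)
  simpa using this

lemma re_smul (c : ℝ) (x : Op H) : c * (τ x).re = (τ ((c : ℂ) • x)).re := by
  rw [map_smul, smul_eq_mul, Complex.re_ofReal_mul]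

lemma q_smul (c : ℝ) (x : Op H) : q τ (c • x) = c ^ 2 * q τ x := by
  unfold q
  have : star (c • x) * (c • x) = ((c ^ 2 : ℝ) : ℂ) • (star x * x) := by
    rw [Complex.coe_smul, star_smul, smul_mul_smul_comm]; simp [sq]
  rw [this, map_smul, smul_eq_mul, Complex.re_ofReal_mul]

lemma q_convex (hτ : IsTracialState (W : Set (Op H)) τ) {x y : Op H} (hx : x ∈ W) (hy : y ∈ W)
    {a b : ℝ} (ha : 0 ≤ a) (hb : 0 ≤ b) (hab : a + b = 1) :
    q τ (a • x + b • y) ≤ a * q τ x + b * q τ y := by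
  have key : q τ (a • x + b • y) + a * b * q τ (x - y) = a * q τ x + b * q τ y := by
    obtain rfl : b = 1 - a := by linarith
    unfold q
    rw [re_smul, re_smul, re_smul, ← Complex.add_re, ← Complex.add_re, ← map_add, ← map_add]
    congr 2
    simp only [Complex.coe_smul, star_add, star_sub, star_smul, star_trivial, add_mul, mul_add,
      sub_mul, mul_sub, smul_mul_smul_comm]
    module
  have := mul_nonneg (mul_nonneg ha hb) (q_nonneg hτ (sub_mem hx hy))
  linarith

lemma q_star (hτ : IsTracialState (W : Set (Op H)) τ) {x : Op H} (hx : x ∈ W) :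
    q τ (star x) = q τ x := by
  unfold q; rw [star_star, hτ.tracial x hx _ (star_mem hx)]

lemma q_mul_left (hτ : IsTracialState (W : Set (Op H)) τ) {a x : Op H} (ha : a ∈ W) (hx : x ∈ W) :
    q τ (a * x) ≤ ‖a‖ ^ 2 * q τ x := by
  have h1 : star a * a ≤ algebraMap ℝ (Op H) (‖a‖ ^ 2) := by
    have := CStarAlgebra.star_mul_le_algebraMap_norm_sq (a := a)
    exact this
  have h2 := star_left_conjugate_le_conjugate h1 x
  have e1 : star x * (star a * a) * x = star (a * x) * (a * x) := by
    simp [mul_assoc]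
  have e2 : star x * algebraMap ℝ (Op H) (‖a‖ ^ 2) * x = ((‖a‖ ^ 2 : ℝ) : ℂ) • (star x * x) := by
    rw [Complex.coe_smul, Algebra.algebraMap_eq_smul_one]; simp
  rw [e1, e2] at h2
  have h3 := tau_mono hτ (mul_mem (star_mem (mul_mem ha hx)) (mul_mem ha hx))
    (vsmul _ (mul_mem (star_mem hx) hx)) h2
  rw [map_smul, smul_eq_mul, Complex.re_ofReal_mul] at h3
  exact h3

lemma q_mul_right (hτ : IsTracialState (W : Set (Op H)) τ) {a x : Op H} (ha : a ∈ W) (hx : x ∈ W) :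
    q τ (x * a) ≤ ‖a‖ ^ 2 * q τ x := by
  rw [← q_star hτ (mul_mem hx ha), star_mul, ← q_star hτ hx, ← norm_star a]
  exact q_mul_left hτ (star_mem ha) (star_mem hx)

lemma q_le_norm (hτ : IsTracialState (W : Set (Op H)) τ) {a : Op H} (ha : a ∈ W) :
    q τ a ≤ ‖a‖ ^ 2 := by
  have := q_mul_left hτ ha (one_mem W)
  have h1 : q τ (1 : Op H) = 1 := by simp [q, hτ.map_one]
  simpa [h1] using this

/-- weak Cauchy-Schwarz -/
lemma tau_cs (hτ : IsTracialState (W : Set (Op H)) τ) {a b : Op H} (ha : a ∈ W) (hb : b ∈ W)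
    {δ : ℝ} (hδ : 0 < δ) :
    -(δ * q τ a + δ⁻¹ * q τ b) ≤ (τ (star a * b)).re + (τ (star b * a)).re := by
  have h := q_nonneg hτ (add_mem (vrsmul δ ha) hb)
  have e : q τ (δ • a + b) = δ ^ 2 * q τ a + q τ b
      + δ * ((τ (star a * b)).re + (τ (star b * a)).re) := by
    unfold q
    rw [← Complex.add_re, ← map_add, re_smul, re_smul, ← Complex.add_re, ← Complex.add_re,
      ← map_add, ← map_add]
    congr 2
    simp only [Complex.coe_smul, star_add, star_smul, star_trivial, add_mul, mul_add,
      smul_mul_smul_comm, smul_mul_assoc, mul_smul_comm]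
    module
  rw [e] at h
  have : 0 ≤ δ⁻¹ * (δ ^ 2 * q τ a + q τ b
      + δ * ((τ (star a * b)).re + (τ (star b * a)).re)) := mul_nonneg (by positivity) h
  have e2 : δ⁻¹ * (δ ^ 2 * q τ a + q τ b
      + δ * ((τ (star a * b)).re + (τ (star b * a)).re)) = δ * q τ a + δ⁻¹ * q τ b +
      ((τ (star a * b)).re + (τ (star b * a)).re) := by
    field_simp
  linarith

end part1

section part2
lemma ultra_lim_exists (ω : Ultrafilter ℕ) {E : Type*} [NormedAddCommGroup E] [ProperSpace E]
    (z : ℕ → E) (C : ℝ) (h : ∀ n, ‖z n‖ ≤ C) : ∃ l, Tendsto z (ω : Filter ℕ) (nhds l) := by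
  have hc : IsCompact (Metric.closedBall (0 : E) C) := isCompact_closedBall 0 C
  obtain ⟨l, -, hl⟩ := hc.ultrafilter_le_nhds (ω.map z) (by
    simp only [le_principal_iff]
    change ∀ᶠ n in (ω : Filter ℕ), z n ∈ Metric.closedBall (0 : E) C
    exact Filter.Eventually.of_forall (fun n => by simpa using h n))
  exact ⟨l, hl⟩

lemma wot_lim (ω : Ultrafilter ℕ) (Y : ℕ → Op H) (hY : Bdd Y) :
    ∃ L : Op H, ∀ v w, Tendsto (fun n => inner ℂ (Y n v) w) (ω : Filter ℕ)
      (nhds (inner ℂ (L v) w)) := by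
  obtain ⟨C, hC⟩ := hY
  have hb : ∀ v w n, ‖inner ℂ (Y n v) w‖ ≤ C * ‖v‖ * ‖w‖ := by
    intro v w n
    calc _ ≤ ‖Y n v‖ * ‖w‖ := norm_inner_le_norm _ _
      _ ≤ _ := by
        gcongr
        exact (Y n).le_of_opNorm_le (hC n) v
  choose B hB using fun v w => ultra_lim_exists ω (fun n => inner ℂ (Y n v) w) _ (hb v w)
  let f : H →ₗ⋆[ℂ] H →ₗ[ℂ] ℂ := LinearMap.mk₂'ₛₗ (starRingEnd ℂ) (RingHom.id ℂ) B
    (fun v v' w => tendsto_nhds_unique (hB _ _) (by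
      simpa [inner_add_left] using (hB v w).add (hB v' w)))
    (fun c v w => tendsto_nhds_unique (hB _ _) (by
      simpa [inner_smul_left, mul_comm] using (hB v w).const_mul (starRingEnd ℂ c)))
    (fun v w w' => tendsto_nhds_unique (hB _ _) (by
      simpa [inner_add_right] using (hB v w).add (hB v w')))
    (fun c v w => tendsto_nhds_unique (hB _ _) (by
      simpa [inner_smul_right] using (hB v w).const_mul c))
  have hf : ∀ v w, ‖f v w‖ ≤ C * ‖v‖ * ‖w‖ := fun v w =>
    le_of_tendsto (hB v w).norm (Eventually.of_forall (hb v w))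
  refine ⟨InnerProductSpace.continuousLinearMapOfBilin (f.mkContinuous₂ C hf), fun v w => ?_⟩
  rw [InnerProductSpace.continuousLinearMapOfBilin_apply]
  exact hB v w

lemma op_nonneg_iff (T : Op H) : 0 ≤ T ↔ ∀ v, 0 ≤ inner ℂ (T v) v := by
  rw [ContinuousLinearMap.nonneg_iff_isPositive, ContinuousLinearMap.isPositive_iff_complex]
  refine forall_congr' fun v => ?_
  rw [Complex.le_def]
  constructor
  · rintro ⟨h1, h2⟩
    refine ⟨h2, ?_⟩
    rw [← h1]; simp
  · rintro ⟨h1, h2⟩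
    refine ⟨?_, h1⟩
    apply Complex.ext
    · simp
    · simpa using h2

lemma wot_mem {W : VonNeumannAlgebra H} {ω : Ultrafilter ℕ} {Y : ℕ → Op H} {L : Op H}
    (hY : ∀ n, Y n ∈ W)
    (h : ∀ v w, Tendsto (fun n => inner ℂ (Y n v) w) (ω : Filter ℕ) (nhds (inner ℂ (L v) w))) :
    L ∈ W := by
  apply mem_of_comm
  intro T hT
  ext v
  refine ext_inner_right ℂ fun w => ?_
  have h1 := h v (star T w)
  have h2 := h (T v) w
  refine tendsto_nhds_unique (f := fun n => inner ℂ ((T * Y n) v) w) (l := (ω : Filter ℕ)) ?_ ?_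
  · have : ∀ x : H, inner ℂ (T x) w = inner ℂ x (star T w) := fun x =>
      (ContinuousLinearMap.adjoint_inner_right T x w).symm
    simp only [mul_apply_eq_comp, this]
    exact h1
  · simp only [← hT _ (hY _)]
    exact h2

section limlemmas
variable {ω : Ultrafilter ℕ} {M Mω : VonNeumannAlgebra H} {τ : Op H →ₗ[ℂ] ℂ}
  {limω : (ℕ → Op H) → Op H}

lemma Bdd.add {x y : ℕ → Op H} (hx : Bdd x) (hy : Bdd y) : Bdd (fun n => x n + y n) := by
  obtain ⟨C, hC⟩ := hx; obtain ⟨D, hD⟩ := hy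
  exact ⟨C + D, fun n => (norm_add_le _ _).trans (add_le_add (hC n) (hD n))⟩

lemma Bdd.mul {x y : ℕ → Op H} (hx : Bdd x) (hy : Bdd y) : Bdd (fun n => x n * y n) := by
  obtain ⟨C, hC⟩ := hx; obtain ⟨D, hD⟩ := hy
  exact ⟨C * D, fun n => (norm_mul_le _ _).trans (mul_le_mul (hC n) (hD n) (norm_nonneg _)
    ((norm_nonneg _).trans (hC n)))⟩

lemma Bdd.smul {x : ℕ → Op H} (c : ℂ) (hx : Bdd x) : Bdd (fun n => c • x n) := by
  obtain ⟨C, hC⟩ := hx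
  exact ⟨‖c‖ * C, fun n => by rw [norm_smul]; gcongr; exact hC n⟩

lemma Bdd.star {x : ℕ → Op H} (hx : Bdd x) : Bdd (fun n => star (x n)) := by
  obtain ⟨C, hC⟩ := hx
  exact ⟨C, fun n => by rw [norm_star]; exact hC n⟩

lemma Bdd.const (a : Op H) : Bdd (fun _ => a) := ⟨‖a‖, fun _ => le_rfl⟩

lemma Bdd.sub {x y : ℕ → Op H} (hx : Bdd x) (hy : Bdd y) : Bdd (fun n => x n - y n) := by
  have := hx.add (hy.smul (-1))
  simpa [sub_eq_add_neg] using this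

lemma lim_sub (hU : IsTracialUltrapower ω M Mω τ limω) {x y : ℕ → Op H}
    (hx : SeqIn (M : Set (Op H)) x) (bx : Bdd x) (hy : SeqIn (M : Set (Op H)) y) (by' : Bdd y) :
    limω (fun n => x n - y n) = limω x - limω y := by
  have h1 := hU.map_add x (fun n => (-1 : ℂ) • y n) hx bx (fun n => vsmul _ (hy n)) (by'.smul _)
  rw [hU.map_smul _ y hy by'] at h1
  simpa [sub_eq_add_neg] using h1

lemma q_lim (hU : IsTracialUltrapower ω M Mω τ limω) {x : ℕ → Op H}
    (hx : SeqIn (M : Set (Op H)) x) (bx : Bdd x) :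
    Tendsto (fun n => q τ (x n)) (ω : Filter ℕ) (nhds (q τ (limω x))) := by
  have h1 := hU.tr (fun n => star (x n) * x n) (fun n => mul_mem (star_mem (hx n)) (hx n))
    (bx.star.mul bx)
  rw [hU.map_mul _ x (fun n => star_mem (hx n)) bx.star hx bx, hU.map_star x hx bx] at h1
  exact (Complex.continuous_re.tendsto _).comp h1

lemma lim_eq_of_q (hU : IsTracialUltrapower ω M Mω τ limω) {x y : ℕ → Op H}
    (hx : SeqIn (M : Set (Op H)) x) (bx : Bdd x) (hy : SeqIn (M : Set (Op H)) y) (by' : Bdd y)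
    (h : Tendsto (fun n => q τ (x n - y n)) (ω : Filter ℕ) (nhds 0)) : limω x = limω y := by
  have h1 := q_lim hU (fun n => sub_mem (hx n) (hy n)) (bx.sub by')
  have h2 := tendsto_nhds_unique h h1
  rw [lim_sub hU hx bx hy by'] at h2
  exact sub_eq_zero.1 (q_zero hU.traceState (sub_mem (hU.mem x hx bx) (hU.mem y hy by')) h2.symm.le)

lemma lim_congr (hU : IsTracialUltrapower ω M Mω τ limω) {x y : ℕ → Op H}
    (hx : SeqIn (M : Set (Op H)) x) (bx : Bdd x) (hy : SeqIn (M : Set (Op H)) y) (by' : Bdd y)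
    (h : ∀ᶠ n in (ω : Filter ℕ), x n = y n) : limω x = limω y := by
  apply lim_eq_of_q hU hx bx hy by'
  refine tendsto_const_nhds.congr' ?_
  filter_upwards [h] with n hn
  simp [hn, q]

lemma lim_nonneg (hU : IsTracialUltrapower ω M Mω τ limω) {x : ℕ → Op H}
    (hx : SeqIn (M : Set (Op H)) x) (bx : Bdd x)
    (h : ∀ᶠ n in (ω : Filter ℕ), 0 ≤ x n) : 0 ≤ limω x := by
  let b := fun n => CFC.sqrt (x n)
  have hb : SeqIn (M : Set (Op H)) b := fun n => sqrt_mem (hx n)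
  have b0 : ∀ n, star (b n) = b n := fun n => (CFC.sqrt_nonneg (x n)).isSelfAdjoint
  have hbb : ∀ n, 0 ≤ x n → star (b n) * b n = x n := fun n h0 => by
    rw [b0, CFC.sqrt_mul_sqrt_self (x n) h0]
  obtain ⟨C, hC⟩ := bx
  have bb : Bdd b := by
    refine ⟨C + 1, fun n => ?_⟩
    by_cases h0 : 0 ≤ x n
    · have h1 := CStarRing.norm_star_mul_self (x := b n)
      rw [hbb n h0] at h1
      have := hC n
      nlinarith [norm_nonneg (b n)]
    · have : b n = 0 := by
        apply cfcₙ_apply_of_not_predicate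
        exact h0
      rw [this, norm_zero]
      linarith [(norm_nonneg _).trans (hC n)]
  have e : limω x = limω (fun n => star (b n) * b n) :=
    lim_congr hU hx ⟨C, hC⟩ (fun n => mul_mem (star_mem (hb n)) (hb n)) (bb.star.mul bb) (by
      filter_upwards [h] with n hn
      rw [hbb n hn])
  rw [e, hU.map_mul _ b (fun n => star_mem (hb n)) bb.star hb bb, hU.map_star b hb bb]
  exact star_mul_self_nonneg _

end limlemmas

open NNReal in
/-- the operator monotone function `s/(1+s)` -/
noncomputable def ff (s : Op H) : Op H := cfcₙ (fun x : ℝ≥0 ↦ 1 - (1 + x)⁻¹) s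

lemma ff_mono {a b : Op H} (ha : 0 ≤ a) (hab : a ≤ b) : ff a ≤ ff b :=
  CFC.monotoneOn_one_sub_one_add_inv ha (ha.trans hab) hab

lemma ff_nonneg (a : Op H) : 0 ≤ ff a := cfcₙ_nonneg_of_predicate

lemma ff_mem {W : VonNeumannAlgebra H} {p : Op H} (hp : p ∈ W) : ff p ∈ W := by
  apply mem_of_comm
  intro T hT
  have : Commute p T := hT p hp
  exact (this.cfcₙ_nnreal _).symm

lemma ff_norm (a : Op H) : ‖ff a‖ ≤ 1 := by
  have : ‖ff a‖₊ ≤ 1 := nnnorm_cfcₙ_nnreal_le (fun x _ => tsub_le_self)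
  exact this

open NNReal in
lemma ff_le {a : Op H} (ha : 0 ≤ a) : ff a ≤ a := by
  have hcont : ContinuousOn (fun x : ℝ≥0 ↦ 1 - (1 + x)⁻¹) (quasispectrum ℝ≥0 a) := by
    fun_prop (disch := intro _ _; positivity)
  conv_rhs => rw [← cfcₙ_id ℝ≥0 a]
  refine cfcₙ_mono ?_ hcont continuousOn_id (by simp) rfl
  intro x _
  simp only [id]
  rw [← NNReal.coe_le_coe, NNReal.coe_sub (by simp)]
  push_cast
  have hx : (0 : ℝ) ≤ x := x.2
  have e : 1 - (1 + (x : ℝ))⁻¹ = x / (1 + x) := by field_simp; ring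
  rw [e]
  exact div_le_self hx (by linarith)

open NNReal in
lemma le_ff {a : Op H} (ha : 0 ≤ a) {C : ℝ≥0} (hC : ‖a‖ ≤ C) : a ≤ (1 + C) • ff a := by
  have hcont : ContinuousOn (fun x : ℝ≥0 ↦ 1 - (1 + x)⁻¹) (quasispectrum ℝ≥0 a) := by
    fun_prop (disch := intro _ _; positivity)
  unfold ff
  rw [← cfcₙ_smul (1 + C) _ a hcont (by simp)]
  conv_lhs => rw [← cfcₙ_id ℝ≥0 a]
  refine cfcₙ_mono ?_ continuousOn_id (hcont.fun_const_smul _) rfl (by simp)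
  intro x hx
  have := (CStarAlgebra.le_nnnorm_of_mem_quasispectrum hx)
  have h2 : (x : ℝ) ≤ C := le_trans this hC
  have hx : (0 : ℝ) ≤ x := x.2
  simp only [id, smul_eq_mul]
  rw [← NNReal.coe_le_coe, NNReal.coe_mul, NNReal.coe_sub (by simp)]
  push_cast
  have e : 1 - (1 + (x : ℝ))⁻¹ = x / (1 + x) := by field_simp; ring
  rw [e, mul_div_assoc', le_div_iff₀ (by linarith)]
  nlinarith

lemma le_ff' {a : Op H} (ha : 0 ≤ a) {C : ℝ} (hC : ‖a‖ ≤ C) : a ≤ ((1 + C : ℝ) : ℂ) • ff a := by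
  have h0 : 0 ≤ C := (norm_nonneg _).trans hC
  have := le_ff ha (C := ⟨C, h0⟩) hC
  rw [Complex.coe_smul]
  exact this

end part2

section part3
variable {ω : Ultrafilter ℕ} {M Mω : VonNeumannAlgebra H} {τ : Op H →ₗ[ℂ] ℂ}
  {limω : (ℕ → Op H) → Op H}

lemma ev_ge (hω : IsFreeUltrafilter ω) (k : ℕ) : ∀ᶠ n in (ω : Filter ℕ), k ≤ n := by
  have h := hω {n | n < k} (Set.finite_lt_nat k)
  have := Ultrafilter.compl_mem_iff_notMem.2 h
  filter_upwards [this] with n hn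
  simpa using hn

lemma free_le (hω : IsFreeUltrafilter ω) : (ω : Filter ℕ) ≤ atTop := by
  rw [← tendsto_id', tendsto_atTop]
  exact ev_ge hω

lemma IsTracialState.mono {W : VonNeumannAlgebra H} (h : IsTracialState (Mω : Set (Op H)) τ)
    (hs : (W : Set (Op H)) ⊆ (Mω : Set (Op H))) : IsTracialState (W : Set (Op H)) τ :=
  ⟨h.map_one, fun x hx y hy => h.tracial x (hs hx) y (hs hy), fun x hx => h.pos x (hs hx),
    fun x hx => h.faithful x (hs hx)⟩

lemma q_lim_const (hU : IsTracialUltrapower ω M Mω τ limω) {z : ℕ → Op H}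
    (hz : SeqIn (M : Set (Op H)) z) (bz : Bdd z) {c : Op H} (hc : c ∈ M) :
    Tendsto (fun n => q τ (z n - c)) (ω : Filter ℕ) (nhds (q τ (limω z - c))) := by
  have h1 := q_lim hU (x := fun n => z n - c) (fun n => sub_mem (hz n) hc) (bz.sub (Bdd.const c))
  rwa [lim_sub hU hz bz (fun _ => hc) (Bdd.const c), hU.diag c hc] at h1

lemma dom (hω : IsFreeUltrafilter ω) (hU : IsTracialUltrapower ω M Mω τ limω) {z c : ℕ → Op H}
    {C : ℝ}
    (hz : SeqIn (M : Set (Op H)) z) (bz : ∀ n, ‖z n‖ ≤ C)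
    (hc : SeqIn (M : Set (Op H)) c) (bc : ∀ n, ‖c n‖ ≤ C) {ε : ℝ}
    (hq : ∀ k, q τ (limω z - c k) < ε * (1 / 2) ^ k) :
    ∃ G ∈ Mω, (τ G).re ≤ 2 * ε ∧ ∀ k, star (limω z - c k) * (limω z - c k) ≤
      ((1 + (2 * C) ^ 2 : ℝ) : ℂ) • G := by
  classical
  have Bz : Bdd z := ⟨C, bz⟩
  have hτ := hU.traceState
  have hτM : IsTracialState (M : Set (Op H)) τ := hτ.mono hU.subset
  have hε : 0 < ε := by
    have := (q_nonneg hτ (sub_mem (hU.mem z hz Bz) (hU.subset (hc 0)))).trans_lt (hq 0)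
    simpa using this
  have hev : ∀ k, ∀ᶠ n in (ω : Filter ℕ), q τ (z n - c k) < ε * (1 / 2) ^ k := fun k =>
    (q_lim_const hU hz Bz (hc k)).eventually (gt_mem_nhds (hq k))
  let y : ℕ → ℕ → Op H := fun k n => star (z n - c k) * (z n - c k)
  have ym : ∀ k n, y k n ∈ M := fun k n =>
    mul_mem (star_mem (sub_mem (hz n) (hc k))) (sub_mem (hz n) (hc k))
  have y0 : ∀ k n, 0 ≤ y k n := fun k n => star_mul_self_nonneg _
  have yn : ∀ k n, ‖y k n‖ ≤ (2 * C) ^ 2 := fun k n => by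
    have h1 : ‖z n - c k‖ ≤ 2 * C := (norm_sub_le _ _).trans (by linarith [bz n, bc k])
    rw [CStarRing.norm_star_mul_self, sq]
    gcongr
    exact (norm_nonneg _).trans h1
  let y' : ℕ → ℕ → Op H := fun k n => if q τ (z n - c k) < ε * (1 / 2) ^ k then y k n else 0
  have ym' : ∀ k n, y' k n ∈ M := fun k n => by
    dsimp only [y']; split_ifs; exacts [ym k n, zero_mem M]
  have y0' : ∀ k n, 0 ≤ y' k n := fun k n => by
    dsimp only [y']; split_ifs; exacts [y0 k n, le_rfl]
  have yt' : ∀ k n, (τ (y' k n)).re ≤ ε * (1 / 2) ^ k := fun k n => by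
    dsimp only [y']; split_ifs with h
    · exact h.le
    · simp; positivity
  let s : ℕ → Op H := fun n => ∑ k ∈ Finset.range (n + 1), y' k n
  have sm : ∀ n, s n ∈ M := fun n => sum_mem (fun k _ => ym' k n)
  have s0 : ∀ n, 0 ≤ s n := fun n => Finset.sum_nonneg (fun k _ => y0' k n)
  have gm : SeqIn (M : Set (Op H)) (fun n => ff (s n)) := fun n => ff_mem (sm n)
  have gb : Bdd (fun n => ff (s n)) := ⟨1, fun n => ff_norm _⟩
  refine ⟨limω (fun n => ff (s n)), hU.mem _ gm gb, ?_, fun k => ?_⟩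
  · refine le_of_tendsto ((Complex.continuous_re.tendsto _).comp (hU.tr _ gm gb))
      (Eventually.of_forall fun n => ?_)
    calc (τ (ff (s n))).re ≤ (τ (s n)).re := tau_mono hτM (gm n) (sm n) (ff_le (s0 n))
      _ = ∑ k ∈ Finset.range (n + 1), (τ (y' k n)).re := by simp [s]
      _ ≤ ∑ k ∈ Finset.range (n + 1), ε * (1 / 2) ^ k := Finset.sum_le_sum fun k _ => yt' k n
      _ = ε * ∑ k ∈ Finset.range (n + 1), (1 / 2) ^ k := by rw [Finset.mul_sum]
      _ ≤ ε * 2 := by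
        gcongr
        exact sum_geometric_two_le _
      _ = 2 * ε := mul_comm _ _
  · have yb : Bdd (y k) := ⟨_, yn k⟩
    have e1 : limω (y k) = star (limω z - c k) * (limω z - c k) := by
      have hzc : SeqIn (M : Set (Op H)) (fun n => z n - c k) := fun n => sub_mem (hz n) (hc k)
      have bzc : Bdd (fun n => z n - c k) := Bz.sub (Bdd.const _)
      rw [hU.map_mul (fun n => star (z n - c k)) (fun n => z n - c k)
        (fun n => star_mem (hzc n)) bzc.star hzc bzc, hU.map_star _ hzc bzc,
        lim_sub hU hz Bz (fun _ => hc k) (Bdd.const _), hU.diag _ (hc k)]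
    rw [← e1, ← hU.map_smul _ _ gm gb, ← sub_nonneg,
      ← lim_sub hU (fun n => vsmul _ (gm n)) (gb.smul _) (ym k) yb]
    apply lim_nonneg hU (fun n => sub_mem (vsmul _ (gm n)) (ym k n)) ((gb.smul _).sub yb)
    filter_upwards [hev k, ev_ge hω k] with n h1 h2
    rw [sub_nonneg]
    have h3 : y k n ≤ s n := by
      have : y' k n = y k n := if_pos h1
      rw [← this]
      exact Finset.single_le_sum (f := fun k => y' k n) (fun i _ => y0' i n)
        (Finset.mem_range.2 (Nat.lt_succ_of_le h2))
    refine (le_ff' (y0 k n) (yn k n)).trans ?_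
    rw [Complex.coe_smul, Complex.coe_smul]
    exact smul_le_smul_of_nonneg_left (ff_mono (y0 k n) h3) (by positivity)

lemma lemmaS0 (hω : IsFreeUltrafilter ω) (hU : IsTracialUltrapower ω M Mω τ limω) {z c : ℕ → Op H}
    {C : ℝ}
    (hz : SeqIn (M : Set (Op H)) z) (bz : ∀ n, ‖z n‖ ≤ C)
    (hc : SeqIn (M : Set (Op H)) c) (bc : ∀ n, ‖c n‖ ≤ C)
    (hq : ∀ k, q τ (limω z - c k) < (1 / 2) ^ k * (1 / 2) ^ k) {T : Op H}
    (hT : ∀ k, T * c k = c k * T) : T * limω z = limω z * T := by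
  have Bz : Bdd z := ⟨C, bz⟩
  set x := limω z with hx
  have xm : x ∈ Mω := hU.mem z hz Bz
  let Y : ℕ → Op H := fun k => star (x - c k) * (x - c k)
  have Ym : ∀ k, Y k ∈ Mω := fun k => mul_mem (star_mem (sub_mem xm (hU.subset (hc k))))
    (sub_mem xm (hU.subset (hc k)))
  have Yb : Bdd Y := ((Bdd.const x).sub ⟨C, bc⟩).star.mul ((Bdd.const x).sub ⟨C, bc⟩)
  obtain ⟨L, hL⟩ := wot_lim ω Y Yb
  have Lm : L ∈ Mω := wot_mem Ym hL
  have L0 : 0 ≤ L := by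
    rw [op_nonneg_iff]
    intro v
    exact ge_of_tendsto (hL v v) (Eventually.of_forall fun k =>
      (op_nonneg_iff (Y k)).1 (star_mul_self_nonneg _) v)
  have key : ∀ m : ℕ, (τ L).re ≤ (1 + (2 * C) ^ 2) * (2 * (1 / 2) ^ m) := by
    intro m
    obtain ⟨G, Gm, Gt, hG⟩ := dom hω hU (c := fun k => c (k + m)) hz bz (fun k => hc _)
      (fun k => bc _) (ε := (1 / 2) ^ m) (fun k => (hq (k + m)).trans_le (by
        have h1 : ((1 : ℝ) / 2) ^ (k + m) ≤ (1 / 2) ^ m :=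
          pow_le_pow_of_le_one (by norm_num) (by norm_num) (by omega)
        have h2 : ((1 : ℝ) / 2) ^ (k + m) ≤ (1 / 2) ^ k :=
          pow_le_pow_of_le_one (by norm_num) (by norm_num) (by omega)
        exact mul_le_mul h1 h2 (by positivity) (by positivity)))
    have hLG : L ≤ ((1 + (2 * C) ^ 2 : ℝ) : ℂ) • G := by
      rw [← sub_nonneg, op_nonneg_iff]
      intro v
      have h1 : Tendsto (fun k => inner ℂ ((((1 + (2 * C) ^ 2 : ℝ) : ℂ) • G - Y k) v) v)
          (ω : Filter ℕ) (nhds (inner ℂ ((((1 + (2 * C) ^ 2 : ℝ) : ℂ) • G - L) v) v)) := by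
        simp only [sub_apply, inner_sub_left]
        exact tendsto_const_nhds.sub (hL v v)
      refine ge_of_tendsto h1 ?_
      filter_upwards [ev_ge hω m] with k hk
      apply (op_nonneg_iff _).1
      rw [sub_nonneg]
      have := hG (k - m)
      rwa [Nat.sub_add_cancel hk] at this
    have := tau_mono hU.traceState Lm (vsmul _ Gm) hLG
    rw [← re_smul] at this
    refine this.trans ?_
    gcongr
  have Lt : (τ L).re ≤ 0 := by
    refine ge_of_tendsto (x := atTop) (f := fun m : ℕ => (1 + (2 * C) ^ 2) * (2 * (1 / 2 : ℝ) ^ m)) ?_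
      (Eventually.of_forall key)
    have := ((tendsto_pow_atTop_nhds_zero_of_lt_one (r := (1 / 2 : ℝ)) (by norm_num)
      (by norm_num)).const_mul 2).const_mul (1 + (2 * C) ^ 2)
    simpa using this
  have hL0 : L = 0 := tau_zero hU.traceState Lm L0 Lt
  have hconv : ∀ v, Tendsto (fun k => (x - c k) v) (ω : Filter ℕ) (nhds 0) := by
    intro v
    have h1 := (hL v v).norm
    rw [hL0] at h1
    have h2 : ∀ k, ‖inner ℂ (Y k v) v‖ = ‖(x - c k) v‖ ^ 2 := fun k => by
      have : inner ℂ (Y k v) v = inner ℂ ((x - c k) v) ((x - c k) v) :=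
        ContinuousLinearMap.adjoint_inner_left (x - c k) v ((x - c k) v)
      rw [this, inner_self_eq_norm_sq_to_K]
      simp
    simp only [h2] at h1
    have h3 := h1.sqrt
    simp only [Real.sqrt_sq (norm_nonneg _)] at h3
    rw [tendsto_zero_iff_norm_tendsto_zero]
    simpa using h3
  ext v
  have h1 := (T.continuous.tendsto _).comp (hconv v)
  have h2 := hconv (T v)
  have h3 := h1.sub h2
  have h4 : ∀ k, T ((x - c k) v) - (x - c k) (T v) = (T * x) v - (x * T) v := fun k => by
    have := congrArg (fun S : Op H => S v) (hT k)
    simp only [mul_apply_eq_comp] at this ⊢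
    simp only [sub_apply, map_sub, this]
    abel
  simp only [Function.comp_def, h4, map_zero, sub_zero] at h3
  exact sub_eq_zero.1 (tendsto_nhds_unique tendsto_const_nhds h3)

/-- If `c k → limω z` in 2-norm, boundedly, then anything commuting with all `c k` commutes
with `limω z`. -/
lemma lemmaS (hω : IsFreeUltrafilter ω) (hU : IsTracialUltrapower ω M Mω τ limω) {x : Op H}
    (xm : x ∈ Mω) {c : ℕ → Op H}
    (hc : SeqIn (M : Set (Op H)) c) (bc : Bdd c)
    (hq : Tendsto (fun k => q τ (x - c k)) atTop (nhds 0)) {T : Op H}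
    (hT : ∀ k, T * c k = c k * T) : T * x = x * T := by
  obtain ⟨z, hz, ⟨C, hC⟩, rfl⟩ := hU.surj x xm
  obtain ⟨D, hD⟩ := bc
  have h1 : ∀ k : ℕ, ∃ n, q τ (limω z - c n) < (1 / 2) ^ k * (1 / 2) ^ k := fun k =>
    (hq.eventually (gt_mem_nhds (by positivity))).exists
  choose φ hφ using h1
  exact lemmaS0 hω hU (c := fun k => c (φ k)) (C := max C D) hz (fun n => (hC n).trans (le_max_left _ _))
    (fun n => hc _) (fun n => (hD _).trans (le_max_right _ _)) hφ (fun k => hT _)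

end part3

section part4
variable {ω : Ultrafilter ℕ} {M Mω : VonNeumannAlgebra H} {τ : Op H →ₗ[ℂ] ℂ}
  {limω : (ℕ → Op H) → Op H}

lemma lim_norm (hU : IsTracialUltrapower ω M Mω τ limω) {z : ℕ → Op H} {C : ℝ}
    (hz : SeqIn (M : Set (Op H)) z) (bz : ∀ n, ‖z n‖ ≤ C) : ‖limω z‖ ≤ C := by
  have C0 : 0 ≤ C := (norm_nonneg _).trans (bz 0)
  have Bz : Bdd z := ⟨C, bz⟩
  have hs : SeqIn (M : Set (Op H)) (fun n => star (z n) * z n) :=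
    fun n => mul_mem (star_mem (hz n)) (hz n)
  have h1m : ((C ^ 2 : ℝ) : ℂ) • (1 : Op H) ∈ M := vsmul _ (one_mem M)
  have h := lim_nonneg hU (x := fun n => ((C ^ 2 : ℝ) : ℂ) • (1 : Op H) - star (z n) * z n)
    (fun n => sub_mem h1m (hs n)) ((Bdd.const _).sub (Bz.star.mul Bz)) (by
      refine Eventually.of_forall fun n => ?_
      rw [sub_nonneg, Complex.coe_smul, ← Algebra.algebraMap_eq_smul_one]
      refine (CStarAlgebra.star_mul_le_algebraMap_norm_sq (a := z n)).trans ?_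
      apply algebraMap_mono
      gcongr
      exact bz n)
  rw [lim_sub hU (fun _ => h1m) (Bdd.const _) hs (Bz.star.mul Bz), hU.diag _ h1m,
    hU.map_mul _ z (fun n => star_mem (hz n)) Bz.star hz Bz, hU.map_star z hz Bz, sub_nonneg,
    Complex.coe_smul, ← Algebra.algebraMap_eq_smul_one] at h
  have h2 := (CStarAlgebra.norm_le_iff_le_algebraMap (star (limω z) * limω z) (by positivity)).2 h
  rw [CStarRing.norm_star_mul_self] at h2
  nlinarith [norm_nonneg (limω z)]

/-- conjugation by `u` -/
noncomputable def Ad (u : Op H) : Op H →ₗ[ℂ] Op H :=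
  (LinearMap.mulLeft ℂ u).comp (LinearMap.mulRight ℂ (star u))

lemma Ad_apply (u x : Op H) : Ad u x = u * x * star u := by simp [Ad, mul_assoc]

/-- averages of unitary conjugations -/
noncomputable def Av (U : Set (Op H)) : Set (Op H →ₗ[ℂ] Op H) := convexHull ℝ (Ad '' U)

lemma Av_ind {U : Set (Op H)} {P : (Op H →ₗ[ℂ] Op H) → Prop} (h1 : ∀ u ∈ U, P (Ad u))
    (h2 : ∀ Φ Ψ, P Φ → P Ψ → ∀ a b : ℝ, 0 ≤ a → 0 ≤ b → a + b = 1 → P (a • Φ + b • Ψ))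
    {Φ : Op H →ₗ[ℂ] Op H} (hΦ : Φ ∈ Av U) : P Φ := by
  have : convexHull ℝ (Ad '' U) ⊆ {Φ | P Φ} := by
    apply convexHull_min
    · rintro _ ⟨u, hu, rfl⟩; exact h1 u hu
    · intro Φ hΦ Ψ hΨ a b ha hb hab
      exact h2 Φ Ψ hΦ hΨ a b ha hb hab
  exact this hΦ

/-- a submonoid of the unitary group of `W` -/
structure UGrp (W : VonNeumannAlgebra H) (U : Set (Op H)) : Prop where
  sub : ∀ u ∈ U, u ∈ W
  one : (1 : Op H) ∈ U
  mul : ∀ u ∈ U, ∀ v ∈ U, u * v ∈ U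
  l : ∀ u ∈ U, star u * u = 1
  r : ∀ u ∈ U, u * star u = 1

lemma Av_mem {W : VonNeumannAlgebra H} {U : Set (Op H)} (hU : UGrp W U) {Φ : Op H →ₗ[ℂ] Op H}
    (hΦ : Φ ∈ Av U) {x : Op H} (hx : x ∈ W) : Φ x ∈ W := by
  refine Av_ind (P := fun Φ => Φ x ∈ W) ?_ ?_ hΦ
  · intro u hu
    rw [Ad_apply]
    exact mul_mem (mul_mem (hU.sub u hu) hx) (star_mem (hU.sub u hu))
  · intro Φ Ψ h1 h2 a b _ _ _
    exact add_mem (vrsmul a h1) (vrsmul b h2)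

lemma u_norm {u : Op H} (h : star u * u = 1) : ‖u‖ ≤ 1 := by
  have h1 := CStarRing.norm_star_mul_self (x := u)
  rw [h] at h1
  have : ‖(1 : Op H)‖ ≤ 1 := ContinuousLinearMap.norm_id_le
  nlinarith [norm_nonneg u]

lemma Av_norm {W : VonNeumannAlgebra H} {U : Set (Op H)} (hU : UGrp W U) {Φ : Op H →ₗ[ℂ] Op H}
    (hΦ : Φ ∈ Av U) (x : Op H) : ‖Φ x‖ ≤ ‖x‖ := by
  refine Av_ind (P := fun Φ => ‖Φ x‖ ≤ ‖x‖) ?_ ?_ hΦ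
  · intro u hu
    rw [Ad_apply]
    have h1 := u_norm (hU.l u hu)
    calc ‖u * x * star u‖ ≤ ‖u‖ * ‖x‖ * ‖star u‖ :=
          (norm_mul_le _ _).trans (mul_le_mul_of_nonneg_right (norm_mul_le _ _) (norm_nonneg _))
      _ ≤ 1 * ‖x‖ * 1 := by rw [norm_star]; gcongr
      _ = ‖x‖ := by ring
  · intro Φ Ψ h1 h2 a b ha hb hab
    calc ‖(a • Φ + b • Ψ) x‖ ≤ ‖a • Φ x‖ + ‖b • Ψ x‖ := norm_add_le _ _
      _ = a * ‖Φ x‖ + b * ‖Ψ x‖ := by rw [norm_smul, norm_smul, Real.norm_of_nonneg ha,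
            Real.norm_of_nonneg hb]
      _ ≤ a * ‖x‖ + b * ‖x‖ := by gcongr
      _ = ‖x‖ := by rw [← add_mul, hab, one_mul]

lemma Av_tau {W : VonNeumannAlgebra H} (hτ : IsTracialState (W : Set (Op H)) τ)
    {U : Set (Op H)} (hU : UGrp W U) {Φ : Op H →ₗ[ℂ] Op H}
    (hΦ : Φ ∈ Av U) {x : Op H} (hx : x ∈ W) : τ (Φ x) = τ x := by
  refine Av_ind (P := fun Φ => τ (Φ x) = τ x) ?_ ?_ hΦ
  · intro u hu
    rw [Ad_apply, hτ.tracial _ (mul_mem (hU.sub u hu) hx) _ (star_mem (hU.sub u hu)), ← mul_assoc,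
      hU.l u hu, one_mul]
  · intro Φ Ψ h1 h2 a b ha hb hab
    have : (a • Φ + b • Ψ) x = (a : ℂ) • Φ x + (b : ℂ) • Ψ x := by
      simp only [Complex.coe_smul]; rfl
    rw [this, map_add, map_smul, map_smul, h1, h2, ← add_smul]
    have : (a : ℂ) + b = 1 := by exact_mod_cast hab
    rw [this, one_smul]

lemma Av_comp {W : VonNeumannAlgebra H} {U : Set (Op H)} (hU : UGrp W U) {Φ : Op H →ₗ[ℂ] Op H}
    (hΦ : Φ ∈ Av U) {u : Op H} (hu : u ∈ U) : (Ad u).comp Φ ∈ Av U := by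
  refine Av_ind (P := fun Φ => (Ad u).comp Φ ∈ Av U) ?_ ?_ hΦ
  · intro v hv
    apply subset_convexHull
    refine ⟨u * v, hU.mul u hu v hv, ?_⟩
    ext1 x
    simp [Ad_apply, mul_assoc]
  · intro Φ Ψ h1 h2 a b ha hb hab
    have : (Ad u).comp (a • Φ + b • Ψ) = a • (Ad u).comp Φ + b • (Ad u).comp Ψ := by
      ext1 x
      simp only [LinearMap.comp_apply, LinearMap.add_apply, LinearMap.smul_apply, Ad_apply, mul_add,
        add_mul, mul_smul_comm, smul_mul_assoc]
    rw [this]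
    exact convex_convexHull ℝ _ h1 h2 ha hb hab

lemma q_Ad {W : VonNeumannAlgebra H} (hτ : IsTracialState (W : Set (Op H)) τ)
    {U : Set (Op H)} (hU : UGrp W U) {u x : Op H} (hu : u ∈ U) (hx : x ∈ W) :
    q τ (Ad u x) = q τ x := by
  unfold q
  rw [Ad_apply]
  have e : star (u * x * star u) * (u * x * star u) = u * (star x * x) * star u := by
    simp only [star_mul, star_star]
    have : u * (star x * star u) * (u * x * star u) = u * (star x * (star u * u) * x) * star u := by
      noncomm_ring
    rw [this, hU.l u hu, mul_one]
  rw [e, hτ.tracial _ (mul_mem (hU.sub u hu) (mul_mem (star_mem hx) hx)) _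
    (star_mem (hU.sub u hu)), ← mul_assoc, hU.l u hu, one_mul]

lemma avg (hω : IsFreeUltrafilter ω) (hP : IsTracialUltrapower ω M Mω τ limω)
    {U : Set (Op H)} (hU : UGrp M U) {y : Op H} (hy : y ∈ M) :
    ∃ Φ : ℕ → (Op H →ₗ[ℂ] Op H), (∀ l, Φ l ∈ Av U) ∧ ∃ c ∈ M, ‖c‖ ≤ ‖y‖ ∧
      (∀ u ∈ U, u * c = c * u) ∧ Tendsto (fun l => q τ (c - Φ l y)) atTop (nhds 0) := by
  have hτ := hP.traceState
  have hτM : IsTracialState (M : Set (Op H)) τ := hτ.mono hP.subset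
  let S : Set ℝ := (fun Φ : Op H →ₗ[ℂ] Op H => q τ (Φ y)) '' Av U
  have Sne : S.Nonempty := ⟨_, Ad 1, subset_convexHull ℝ _ ⟨1, hU.one, rfl⟩, rfl⟩
  have Sb : BddBelow S := ⟨0, by
    rintro _ ⟨Φ, hΦ, rfl⟩; exact q_nonneg hτM (Av_mem hU hΦ hy)⟩
  set I := sInf S with hI
  have hIle : ∀ Φ ∈ Av U, I ≤ q τ (Φ y) := fun Φ hΦ => csInf_le Sb ⟨Φ, hΦ, rfl⟩
  have h1 : ∀ l : ℕ, ∃ Φ ∈ Av U, q τ (Φ y) < I + 1 / ((l : ℝ) + 1) := fun l => by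
    obtain ⟨_, ⟨Φ, hΦ, rfl⟩, h⟩ := exists_lt_of_csInf_lt Sne
      (show sInf S < I + 1 / ((l : ℝ) + 1) by rw [← hI]; linarith [Nat.one_div_pos_of_nat (α := ℝ) (n := l)])
    exact ⟨Φ, hΦ, h⟩
  have h2 : ∀ Φ ∈ Av U, ∀ Ψ ∈ Av U, q τ (Φ y - Ψ y) ≤ 2 * q τ (Φ y) + 2 * q τ (Ψ y) - 4 * I := by
    intro Φ hΦ Ψ hΨ
    have h3 := hIle _ (convex_convexHull ℝ (Ad '' U) hΦ hΨ (a := 1 / 2) (b := 1 / 2) (by norm_num)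
      (by norm_num) (by norm_num))
    have h4 : ((1 / 2 : ℝ) • Φ + (1 / 2 : ℝ) • Ψ) y = (1 / 2 : ℝ) • (Φ y + Ψ y) := by
      rw [smul_add]; rfl
    rw [h4, q_smul] at h3
    have := q_para (τ := τ) (Φ y) (Ψ y)
    linarith
  choose Φ hΦ hΦq using h1
  let z : ℕ → Op H := fun l => Φ l y
  have zm : SeqIn (M : Set (Op H)) z := fun l => Av_mem hU (hΦ l) hy
  have zb : ∀ l, ‖z l‖ ≤ ‖y‖ := fun l => Av_norm hU (hΦ l) y
  have Zb : Bdd z := ⟨_, zb⟩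
  set c := limω z with hc
  have cm : c ∈ Mω := hP.mem z zm Zb
  have hcz : ∀ l : ℕ, q τ (c - z l) ≤ 4 * (1 / ((l : ℝ) + 1)) := by
    intro l
    refine le_of_tendsto (q_lim_const hP zm Zb (zm l)) ?_
    filter_upwards [ev_ge hω l] with n hn
    have h3 := h2 _ (hΦ n) _ (hΦ l)
    have h4 := hΦq n
    have h5 := hΦq l
    have h6 : 1 / ((n : ℝ) + 1) ≤ 1 / ((l : ℝ) + 1) := Nat.one_div_le_one_div hn
    change q τ (Φ n y - Φ l y) ≤ _
    linarith
  have ht0 : Tendsto (fun l : ℕ => 4 * (1 / ((l : ℝ) + 1))) atTop (nhds 0) := by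
    simpa using (tendsto_one_div_add_atTop_nhds_zero_nat (𝕜 := ℝ)).const_mul 4
  have htend : Tendsto (fun l => q τ (c - z l)) atTop (nhds 0) :=
    squeeze_zero (fun l => q_nonneg hτ (sub_mem cm (hP.subset (zm l)))) hcz ht0
  have cM : c ∈ M := mem_of_comm fun T hT =>
    lemmaS hω hP cm zm Zb htend (fun k => (hT _ (zm k)).symm)
  refine ⟨Φ, hΦ, c, cM, lim_norm hP zm zb, fun u hu => ?_, htend⟩
  have hAm : ∀ x ∈ M, Ad u x ∈ M := fun x hx => by
    rw [Ad_apply]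
    exact mul_mem (mul_mem (hU.sub u hu) hx) (star_mem (hU.sub u hu))
  have h3 : Ad u c - c = 0 := by
    refine q_zero hτM (sub_mem (hAm c cM) cM) ?_
    refine ge_of_tendsto (x := atTop) (f := fun l : ℕ => 10 * (4 * (1 / ((l : ℝ) + 1)))) (by
      simpa using ht0.const_mul 10) (Eventually.of_forall fun l => ?_)
    have a1 : q τ (Ad u c - Ad u (z l)) ≤ 4 * (1 / ((l : ℝ) + 1)) := by
      rw [← map_sub, q_Ad hτM hU hu (sub_mem cM (zm l))]; exact hcz l
    have a2 : q τ (Ad u (z l) - z l) ≤ 4 * (1 / ((l : ℝ) + 1)) := by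
      have b1 := h2 _ (Av_comp hU (hΦ l) hu) _ (hΦ l)
      have b2 := hΦq l
      have b3 : q τ (((Ad u).comp (Φ l)) y) = q τ (Φ l y) := q_Ad hτM hU hu (zm l)
      rw [b3] at b1
      change q τ (((Ad u).comp (Φ l)) y - Φ l y) ≤ _
      linarith
    have a3 : q τ (z l - c) ≤ 4 * (1 / ((l : ℝ) + 1)) := by rw [q_sub_comm]; exact hcz l
    have t1 := q_tri hτM (hAm c cM) (hAm _ (zm l)) cM
    have t2 := q_tri hτM (hAm _ (zm l)) (zm l) cM
    have : 0 < 1 / ((l : ℝ) + 1) := Nat.one_div_pos_of_nat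
    linarith
  rw [Ad_apply, sub_eq_zero] at h3
  calc u * c = u * c * (star u * u) := by rw [hU.l u hu, mul_one]
    _ = c * u := by rw [← mul_assoc, h3]

end part4

section part5
variable {ω : Ultrafilter ℕ} {M Mω W : VonNeumannAlgebra H} {τ : Op H →ₗ[ℂ] ℂ}
  {limω : (ℕ → Op H) → Op H}

lemma tau_star (hτ : IsTracialState (W : Set (Op H)) τ) {y : Op H} (hy : y ∈ W) :
    τ (star y) = starRingEnd ℂ (τ y) := by
  have h1 := congrArg Complex.im (tau_eq_q hτ (add_mem (one_mem W) hy))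
  have h2 := congrArg Complex.im (tau_eq_q hτ (add_mem (one_mem W) (vsmul Complex.I hy)))
  have h3 := congrArg Complex.im (tau_eq_q hτ hy)
  have e1 : star (1 + y) * (1 + y) = 1 + y + star y + star y * y := by
    simp only [star_add, star_one]; noncomm_ring
  have e2 : star (1 + Complex.I • y) * (1 + Complex.I • y)
      = 1 + Complex.I • y + (-Complex.I) • star y + star y * y := by
    simp only [star_add, star_one, star_smul, add_mul, mul_add, one_mul, mul_one,
      smul_mul_smul_comm]
    simp
    abel
  rw [e1] at h1
  rw [e2] at h2
  simp only [map_add, map_smul, hτ.map_one] at h1 h2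
  simp at h1 h2 h3
  apply Complex.ext
  · simp; linarith
  · simp; linarith

lemma tau_CS (hτ : IsTracialState (W : Set (Op H)) τ) {a b : Op H} (ha : a ∈ W) (hb : b ∈ W) :
    ‖τ (star a * b)‖ ^ 2 ≤ q τ a * q τ b := by
  obtain ⟨ζ, hζ, hζ2⟩ : ∃ ζ : ℂ, ‖ζ‖ = 1 ∧ ζ * τ (star a * b) = (‖τ (star a * b)‖ : ℂ) := by
    by_cases h : τ (star a * b) = 0
    · exact ⟨1, by simp, by simp [h]⟩
    · refine ⟨(‖τ (star a * b)‖ : ℂ) / τ (star a * b), ?_, ?_⟩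
      · rw [norm_div]; simp [h]
      · field_simp
  set r := ‖τ (star a * b)‖ with hr
  have hq : ∀ s : ℝ, 0 ≤ q τ a * (s * s) + (2 * r) * s + q τ b := by
    intro s
    have h0 := q_nonneg hτ (add_mem (vsmul (s : ℂ) ha) (vsmul ζ hb))
    have hst : τ (star b * a) = starRingEnd ℂ (τ (star a * b)) := by
      rw [← tau_star hτ (mul_mem (star_mem ha) hb)]; simp
    have e : star ((s : ℂ) • a + ζ • b) * ((s : ℂ) • a + ζ • b)
        = ((s : ℂ) * s) • (star a * a) + ((s : ℂ) * ζ) • (star a * b)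
          + (starRingEnd ℂ ζ * s) • (star b * a) + (starRingEnd ℂ ζ * ζ) • (star b * b) := by
      simp only [star_add, star_smul, add_mul, mul_add, smul_mul_smul_comm]
      simp
      abel
    have h1 : starRingEnd ℂ ζ * starRingEnd ℂ (τ (star a * b)) = r := by
      rw [← map_mul, hζ2]; simp
    have h2 : starRingEnd ℂ ζ * ζ = 1 := by
      rw [mul_comm, Complex.mul_conj, Complex.normSq_eq_norm_sq, hζ]; simp
    have h3 : q τ ((s : ℂ) • a + ζ • b) = q τ a * (s * s) + (2 * r) * s + q τ b := by
      rw [q, e, h2]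
      simp only [map_add, map_smul, smul_eq_mul, hst, tau_eq_q hτ ha, tau_eq_q hτ hb]
      rw [mul_assoc (s : ℂ) ζ, hζ2, mul_right_comm (starRingEnd ℂ ζ) (s : ℂ), h1]
      simp
      ring
    rw [← h3]; exact h0
  have := discrim_le_zero hq
  rw [discrim] at this
  nlinarith

lemma tau_le_q (hτ : IsTracialState (W : Set (Op H)) τ) {b : Op H} (hb : b ∈ W) :
    ‖τ b‖ ^ 2 ≤ q τ b := by
  have := tau_CS hτ (one_mem W) hb
  have h1 : q τ 1 = 1 := by simp [q, hτ.map_one]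
  simpa [h1] using this

/-- unitaries of `W` commuting with `A` -/
def UU (W : VonNeumannAlgebra H) (A : Set (Op H)) : Set (Op H) :=
  {u | u ∈ W ∧ (∀ a ∈ A, a * u = u * a) ∧ star u * u = 1 ∧ u * star u = 1}

lemma UU_grp {N M : VonNeumannAlgebra H} (h : (N : Set (Op H)) ⊆ M) (A : Set (Op H)) :
    UGrp M (UU N A) where
  sub u hu := h hu.1
  one := ⟨one_mem N, by simp, by simp, by simp⟩
  mul u hu v hv := by
    refine ⟨mul_mem hu.1 hv.1, fun a ha => ?_, ?_, ?_⟩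
    · rw [← mul_assoc, hu.2.1 a ha, mul_assoc, hv.2.1 a ha, mul_assoc]
    · rw [star_mul, mul_assoc, ← mul_assoc (star u), hu.2.2.1, one_mul, hv.2.2.1]
    · rw [star_mul, mul_assoc, ← mul_assoc v, hv.2.2.2, one_mul, hu.2.2.2]
  l u hu := hu.2.2.1
  r u hu := hu.2.2.2

lemma vn_closed (N : VonNeumannAlgebra H) : IsClosed (N : Set (Op H)) := by
  rw [← N.centralizer_centralizer]
  exact Set.isClosed_centralizer _

lemma comm_of_UU {N : VonNeumannAlgebra H} {A : Set (Op H)} (hA : ∀ a ∈ A, star a ∈ A) {c : Op H}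
    (hc : ∀ u ∈ UU N A, u * c = c * u) {x : Op H} (hx : x ∈ N) (hxA : ∀ a ∈ A, a * x = x * a) :
    x * c = c * x := by
  let S : StarSubalgebra ℂ (Op H) := N.toStarSubalgebra ⊓ StarSubalgebra.centralizer ℂ A
  have hS : ∀ y, y ∈ S ↔ y ∈ N ∧ ∀ a ∈ A, a * y = y * a := by
    intro y
    constructor
    · rintro ⟨h1, h2⟩
      refine ⟨h1, fun a ha => ?_⟩
      exact ((StarSubalgebra.mem_centralizer_iff ℂ).1 h2 a ha).1
    · rintro ⟨h1, h2⟩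
      exact ⟨h1, (StarSubalgebra.mem_centralizer_iff ℂ).2 fun a ha => ⟨h2 a ha, h2 _ (hA a ha)⟩⟩
  have hcl : IsClosed (S : Set (Op H)) := by
    have : (S : Set (Op H)) = (N : Set (Op H)) ∩ Set.centralizer A := by
      ext y
      rw [SetLike.mem_coe, hS]; rfl
    rw [this]
    exact (vn_closed N).inter (Set.isClosed_centralizer _)
  haveI : CompleteSpace S := hcl.completeSpace_coe
  haveI : IsClosed (S : Set (Op H)) := hcl
  letI : CStarAlgebra S := {}
  have key : (⟨x, (hS x).2 ⟨hx, hxA⟩⟩ : S) ∈ Submodule.span ℂ (unitary S : Set S) := by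
    rw [CStarAlgebra.span_unitary]; trivial
  have : ∀ z ∈ Submodule.span ℂ (unitary S : Set S), (z : Op H) * c = c * z := by
    intro z hz
    induction hz using Submodule.span_induction with
    | mem z hz =>
      refine hc z ⟨((hS z).1 z.2).1, ((hS z).1 z.2).2, ?_, ?_⟩
      · exact congrArg Subtype.val (Unitary.mem_iff.1 hz).1
      · exact congrArg Subtype.val (Unitary.mem_iff.1 hz).2
    | zero => simp
    | add y z _ _ h1 h2 => simp [add_mul, mul_add, h1, h2]
    | smul a y _ h => simp [h]
  exact this _ key

end part5

section part6
variable {ω : Ultrafilter ℕ} {M Mω N W : VonNeumannAlgebra H} {τ : Op H →ₗ[ℂ] ℂ}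
  {limω : (ℕ → Op H) → Op H}

lemma tau_tend (hτ : IsTracialState (W : Set (Op H)) τ) {z : ℕ → Op H} (hz : ∀ n, z n ∈ W)
    {b : Op H} (hb : b ∈ W) (hq : Tendsto (fun n => q τ (z n)) atTop (nhds 0)) :
    Tendsto (fun n => τ (z n * b)) atTop (nhds 0) := by
  have h1 : ∀ n, ‖τ (z n * b)‖ ^ 2 ≤ q τ (z n) * q τ b := fun n => by
    have := tau_CS hτ (star_mem (hz n)) hb
    rwa [star_star, q_star hτ (hz n)] at this
  have h2 : Tendsto (fun n => ‖τ (z n * b)‖ ^ 2) atTop (nhds 0) :=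
    squeeze_zero (fun n => by positivity) h1 (by simpa using hq.mul_const (q τ b))
  have h3 := h2.sqrt
  simp only [Real.sqrt_sq (norm_nonneg _), Real.sqrt_zero] at h3
  exact tendsto_zero_iff_norm_tendsto_zero.2 h3

lemma avg_scalar (hω : IsFreeUltrafilter ω) (hP : IsTracialUltrapower ω M Mω τ limω)
    (hNM : (N : Set (Op H)) ⊆ M) (hirr : relComm (N : Set (Op H)) (M : Set (Op H)) = scalars H)
    {y : Op H} (hy : y ∈ M) :
    ∃ Φ : ℕ → (Op H →ₗ[ℂ] Op H), (∀ l, Φ l ∈ Av (UU N ∅)) ∧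
      Tendsto (fun l => q τ (τ y • 1 - Φ l y)) atTop (nhds 0) := by
  have hG : UGrp M (UU N ∅) := UU_grp hNM ∅
  have hτ : IsTracialState (M : Set (Op H)) τ := hP.traceState.mono hP.subset
  obtain ⟨Φ, hΦ, c, cM, -, hc, ht⟩ := avg hω hP hG hy
  refine ⟨Φ, hΦ, ?_⟩
  have h1 : c ∈ relComm (N : Set (Op H)) (M : Set (Op H)) :=
    ⟨cM, fun x hx => comm_of_UU (A := ∅) (by simp) hc hx (by simp)⟩
  rw [hirr] at h1
  obtain ⟨μ, rfl⟩ := h1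
  have h2 := tau_tend hτ (fun l => sub_mem cM (Av_mem hG (hΦ l) hy)) (one_mem M) ht
  have h3 : μ - τ y = 0 := by
    refine tendsto_nhds_unique ?_ h2
    refine tendsto_const_nhds.congr fun l => ?_
    rw [mul_one, map_sub, Av_tau hτ hG (hΦ l) hy, map_smul, hτ.map_one]; simp
  rw [sub_eq_zero] at h3
  rwa [← h3]

lemma corner0 (hω : IsFreeUltrafilter ω) (hP : IsTracialUltrapower ω M Mω τ limω)
    (hNM : (N : Set (Op H)) ⊆ M) (hirr : relComm (N : Set (Op H)) (M : Set (Op H)) = scalars H)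
    {e t : Op H} (he : e ∈ N) (he0 : e ≠ 0) (ht : t ∈ M)
    (h2 : t * e = t) (hc : ∀ n ∈ N, t * (n * e) = e * n * t)
    (h0 : τ (star e * t) = 0) : t = 0 := by
  have hG : UGrp M (UU N ∅) := UU_grp hNM ∅
  have hτ : IsTracialState (M : Set (Op H)) τ := hP.traceState.mono hP.subset
  have eM : e ∈ M := hNM he
  have wM : star e * t ∈ M := mul_mem (star_mem eM) ht
  have hM : star e * e ∈ M := mul_mem (star_mem eM) eM
  have XM : t * star t ∈ M := mul_mem ht (star_mem ht)
  obtain ⟨Φ, hΦ, hΦt⟩ := avg_scalar hω hP hNM hirr wM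
  obtain ⟨Ψ, hΨ, hΨt⟩ := avg_scalar hω hP hNM hirr XM
  have hΦt' : Tendsto (fun l => q τ (Φ l (star e * t))) atTop (nhds 0) := by
    refine hΦt.congr fun l => ?_
    rw [h0, zero_smul, zero_sub, q_neg]
  have key : ∀ F ∈ Av (UU N ∅), ∀ n ∈ N, F (star e * t) * (n * e) = F (star e * e) * (n * t) := by
    intro F hF n hn
    refine Av_ind (P := fun F => F (star e * t) * (n * e) = F (star e * e) * (n * t)) ?_ ?_ hF
    · intro u hu
      have := hc (star u * n) (mul_mem (star_mem hu.1) hn)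
      simp only [Ad_apply]
      calc u * (star e * t) * star u * (n * e) = u * star e * (t * (star u * n * e)) := by
            simp only [mul_assoc]
        _ = _ := by rw [this]; simp only [mul_assoc]
    · intro F G h1 h2 a b _ _ _
      simp only [LinearMap.add_apply, LinearMap.smul_apply, add_mul, smul_mul_assoc, h1, h2]
  have hlim : ∀ G ∈ Av (UU N ∅),
      Tendsto (fun l => τ (Φ l (star e * e) * G (t * star t))) atTop (nhds 0) := by
    intro G hG'
    refine Av_ind (P := fun G =>
      Tendsto (fun l => τ (Φ l (star e * e) * G (t * star t))) atTop (nhds 0)) ?_ ?_ hG'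
    · intro u hu
      have := tau_tend hτ (fun l => Av_mem hG (hΦ l) wM) (b := u * e * star t * star u)
        (mul_mem (mul_mem (mul_mem (hNM hu.1) eM) (star_mem ht)) (star_mem (hNM hu.1))) hΦt'
      refine this.congr fun l => congrArg τ ?_
      rw [Ad_apply]
      calc _ = Φ l (star e * t) * (u * e) * (star t * star u) := by simp only [mul_assoc]
        _ = _ := by rw [key _ (hΦ l) u hu.1]; simp only [mul_assoc]
    · intro F G h1 h2 a b _ _ _
      have := (h1.const_mul (a : ℂ)).add (h2.const_mul (b : ℂ))
      simp only [mul_zero, add_zero] at this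
      refine this.congr fun l => ?_
      simp only [LinearMap.add_apply, LinearMap.smul_apply, mul_add, mul_smul_comm, map_add]
      rw [← Complex.coe_smul, ← Complex.coe_smul b, map_smul, map_smul]
      rfl
  have hb : ∀ m, ‖τ (star e * e) * τ (t * star t)‖ ^ 2
      ≤ ‖star e * e‖ ^ 2 * q τ (τ (t * star t) • 1 - Ψ m (t * star t)) := by
    intro m
    have hDm : τ (t * star t) • 1 - Ψ m (t * star t) ∈ M :=
      sub_mem (vsmul _ (one_mem M)) (Av_mem hG (hΨ m) XM)
    have hl := (tendsto_const_nhds (x := τ (star e * e) * τ (t * star t))).sub (hlim _ (hΨ m))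
    rw [sub_zero] at hl
    refine le_of_tendsto (hl.norm.pow 2) (Eventually.of_forall fun l => ?_)
    have hFm := Av_mem hG (hΦ l) hM
    have h3 := tau_CS hτ (star_mem hFm) hDm
    rw [star_star, q_star hτ hFm, mul_sub, map_sub, mul_smul_comm, mul_one, map_smul,
      Av_tau hτ hG (hΦ l) hM, smul_eq_mul, mul_comm (τ (t * star t))] at h3
    refine h3.trans ?_
    have h4 := q_nonneg hτ hDm
    have h5 := q_le_norm hτ hFm
    have h6 := Av_norm hG (hΦ l) (star e * e)
    have h7 : q τ (Φ l (star e * e)) ≤ ‖star e * e‖ ^ 2 := h5.trans (by gcongr)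
    exact mul_le_mul_of_nonneg_right h7 h4
  have hz : ‖τ (star e * e) * τ (t * star t)‖ ^ 2 ≤ 0 :=
    ge_of_tendsto' (by simpa using hΨt.const_mul (‖star e * e‖ ^ 2)) hb
  have hz2 : τ (star e * e) * τ (t * star t) = 0 := by
    have : ‖τ (star e * e) * τ (t * star t)‖ ^ 2 = 0 := le_antisymm hz (by positivity)
    simpa using this
  rcases mul_eq_zero.1 hz2 with h | h
  · exact absurd (hτ.faithful e eM h) he0
  · rw [hτ.tracial t ht _ (star_mem ht)] at h
    exact hτ.faithful t ht h

lemma corner1 (hω : IsFreeUltrafilter ω) (hP : IsTracialUltrapower ω M Mω τ limω)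
    (hNM : (N : Set (Op H)) ⊆ M) (hirr : relComm (N : Set (Op H)) (M : Set (Op H)) = scalars H)
    {e t : Op H} (he : e ∈ N) (hee : e * e = e) (ht : t ∈ M)
    (h2 : t * e = t) (hc : ∀ n ∈ N, t * (n * e) = e * n * t) : ∃ c : ℂ, t = c • e := by
  have hτ : IsTracialState (M : Set (Op H)) τ := hP.traceState.mono hP.subset
  by_cases he0 : e = 0
  · exact ⟨0, by rw [← h2, he0]; simp⟩
  have hne : τ (star e * e) ≠ 0 := fun h => he0 (hτ.faithful e (hNM he) h)
  refine ⟨τ (star e * t) / τ (star e * e), sub_eq_zero.1 ?_⟩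
  set c := τ (star e * t) / τ (star e * e)
  refine corner0 hω hP hNM hirr he he0 (sub_mem ht (vsmul c (hNM he))) ?_ ?_ ?_
  · rw [sub_mul, h2, smul_mul_assoc, hee]
  · intro n hn
    rw [sub_mul, mul_sub, hc n hn, smul_mul_assoc, mul_smul_comm, mul_assoc e n e]
  · rw [mul_sub, map_sub, mul_smul_comm, map_smul, smul_eq_mul, sub_eq_zero]
    exact (div_mul_cancel₀ _ hne).symm

end part6

section part7
variable {ω : Ultrafilter ℕ} {M Mω N W : VonNeumannAlgebra H} {τ : Op H →ₗ[ℂ] ℂ}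
  {limω : (ℕ → Op H) → Op H}

lemma fd (A : StarSubalgebra ℂ (Op H)) (hA : FinDim (A : Set (Op H))) : FiniteDimensional ℂ A := by
  obtain ⟨s, hs⟩ := hA
  have h1 : FiniteDimensional ℂ (Submodule.span ℂ (s : Set (Op H))) :=
    FiniteDimensional.span_finset ℂ s
  exact Submodule.finiteDimensional_of_le (S₁ := Subalgebra.toSubmodule A.toSubalgebra)
    (S₂ := Submodule.span ℂ (s : Set (Op H))) hs

lemma sa_nil {y : Op H} (hy : IsSelfAdjoint y) {n : ℕ} (h : y ^ n = 0) : y = 0 := by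
  have h1 : y ^ (2 ^ n) = 0 := by
    rw [← Nat.sub_add_cancel (Nat.lt_two_pow_self (n := n)).le, pow_add, h, mul_zero]
  have h2 := hy.nnnorm_pow_two_pow n
  rw [h1, nnnorm_zero] at h2
  simpa using h2.symm

lemma semis (A : StarSubalgebra ℂ (Op H)) [FiniteDimensional ℂ A] : IsSemisimpleRing A := by
  have : IsArtinianRing A := IsArtinianRing.of_finite ℂ A
  rw [IsArtinianRing.isSemisimpleRing_iff_jacobson, eq_bot_iff]
  obtain ⟨n, hn⟩ := IsSemiprimaryRing.isNilpotent (R := A)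
  intro x hx
  have h1 : star x * x ∈ Ring.jacobson A := Ideal.mul_mem_left _ _ hx
  have h2 : (star x * x) ^ n ∈ Ring.jacobson A ^ n := Ideal.pow_mem_pow h1 n
  rw [hn] at h2
  have h3 : (star x * x) ^ n = 0 := by simpa using h2
  have h4 : (star (x : Op H) * x) ^ n = 0 := congrArg Subtype.val h3
  have h5 := sa_nil (IsSelfAdjoint.star_mul_self (x : Op H)) h4
  have h6 : (x : Op H) = 0 := by simpa using h5
  exact Subtype.ext h6

lemma units (A : StarSubalgebra ℂ (Op H)) (hA : FinDim (A : Set (Op H))) :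
    ∃ (k : ℕ) (d : Fin k → ℕ) (E : (i : Fin k) → Fin (d i) → Fin (d i) → Op H),
      (∀ i, NeZero (d i)) ∧ (∀ i a b, E i a b ∈ A) ∧
      (∀ i a b c, E i a b * E i b c = E i a c) ∧
      (∀ i a b b' c, b ≠ b' → E i a b * E i b' c = 0) ∧
      (∀ i j a b c e, i ≠ j → E i a b * E j c e = 0) ∧
      (∑ i, ∑ a, E i a a = 1) ∧
      (∀ T, (∀ i a b, E i a b * T = T * E i a b) → ∀ x ∈ A, x * T = T * x) := by
  have := fd A hA
  have := semis A
  obtain ⟨k, d, hd, ⟨φ⟩⟩ := IsSemisimpleRing.exists_algEquiv_pi_matrix_of_isAlgClosed ℂ A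
  let F : (i : Fin k) → Fin (d i) → Fin (d i) → ((i : Fin k) → Matrix (Fin (d i)) (Fin (d i)) ℂ) :=
    fun i a b => Pi.single i (Matrix.single a b 1)
  refine ⟨k, d, fun i a b => (φ.symm (F i a b) : A), hd, fun i a b => (φ.symm (F i a b)).2,
    ?_, ?_, ?_, ?_, ?_⟩
  · intro i a b c
    rw [← MulMemClass.coe_mul, ← map_mul]
    simp only [F]
    rw [← Pi.single_mul]
    simp
  · intro i a b b' c h
    rw [← MulMemClass.coe_mul, ← map_mul]
    simp only [F]
    rw [← Pi.single_mul]
    simp [h]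
  · intro i j a b c e h
    rw [← MulMemClass.coe_mul, ← map_mul]
    simp only [F]
    have : (Pi.single i (Matrix.single a b 1) * Pi.single j (Matrix.single c e 1) :
        (i : Fin k) → Matrix (Fin (d i)) (Fin (d i)) ℂ) = 0 := by
      funext l
      by_cases hl : l = i
      · subst hl
        simp [Pi.single_eq_of_ne h]
      · simp [Pi.single_eq_of_ne hl]
    rw [this]
    simp
  · have h1 : ∑ i, ∑ a, F i a a = 1 := by
      funext j
      simp only [F, Finset.sum_apply]
      rw [Finset.sum_eq_single j]
      · simp only [Pi.single_eq_same]
        ext a b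
        simp [Matrix.sum_apply, Matrix.single_apply, Matrix.one_apply]
        by_cases hab : a = b
        · subst hab; simp [Finset.filter_eq']
        · rw [if_neg hab, Finset.filter_eq_empty_iff.2]
          · simp
          · rintro x - ⟨rfl, h⟩; exact hab h
      · intro b _ hb
        simp [Pi.single_eq_of_ne hb.symm]
      · simp
    have h2 := congrArg (fun z => ((φ.symm z : A) : Op H)) h1
    simpa using h2
  · intro T hT x hx
    have h1 : φ ⟨x, hx⟩ = ∑ i, ∑ a, ∑ b, (φ ⟨x, hx⟩ i a b) • F i a b := by
      funext j
      simp only [F, Finset.sum_apply, Pi.smul_apply]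
      rw [Finset.sum_eq_single j]
      · simp only [Pi.single_eq_same]
        conv_lhs => rw [Matrix.matrix_eq_sum_single (φ ⟨x, hx⟩ j)]
        simp
      · intro b _ hb
        simp [Pi.single_eq_of_ne hb.symm]
      · simp
    have h2 := congrArg (fun z => ((φ.symm z : A) : Op H)) h1
    simp only [AlgEquiv.symm_apply_apply, map_sum, map_smul] at h2
    have h3 : ∃ f : (i : Fin k) → Fin (d i) → Fin (d i) → ℂ,
        x = ∑ i, ∑ a, ∑ b, f i a b • ((φ.symm (F i a b) : A) : Op H) := by
      refine ⟨fun i a b => φ ⟨x, hx⟩ i a b, h2.trans ?_⟩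
      simp
    obtain ⟨f, h3⟩ := h3
    rw [h3]
    simp only [Finset.sum_mul, Finset.mul_sum, smul_mul_assoc, mul_smul_comm, hT]

lemma bicomm (hω : IsFreeUltrafilter ω) (hP : IsTracialUltrapower ω M Mω τ limω)
    (hNM : (N : Set (Op H)) ⊆ M) (hirr : relComm (N : Set (Op H)) (M : Set (Op H)) = scalars H)
    (A : StarSubalgebra ℂ (Op H)) (hA : FinDim (A : Set (Op H))) (hAN : (A : Set (Op H)) ⊆ N)
    {c : Op H} (hc : c ∈ M) (hcc : ∀ u ∈ UU N (A : Set (Op H)), u * c = c * u) : c ∈ A := by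
  obtain ⟨k, d, E, hd, mE, e1, e2, e3, e4, e5⟩ := units A hA
  let T : Fin k → Op H → Op H := fun i n => ∑ a, E i a 0 * n * E i 0 a
  have cT : ∀ i, ∀ n ∈ N, T i n * c = c * T i n := by
    intro i n hn
    refine comm_of_UU (A := (A : Set (Op H))) (fun a ha => A.star_mem' ha) hcc ?_ ?_
    · exact sum_mem fun a _ => mul_mem (mul_mem (hAN (mE i a 0)) hn) (hAN (mE i 0 a))
    · refine e5 _ ?_
      intro j a b
      simp only [T, Finset.mul_sum, Finset.sum_mul]
      by_cases hij : j = i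
      · subst hij
        rw [Finset.sum_eq_single b, Finset.sum_eq_single a]
        · rw [mul_assoc _ (E j 0 a), e1, ← mul_assoc, ← mul_assoc, e1]
        · intro x _ hx
          rw [mul_assoc _ (E j 0 x), e2 _ _ _ _ _ hx, mul_zero]
        · simp
        · intro x _ hx
          rw [← mul_assoc, ← mul_assoc, e2 _ _ _ _ _ hx.symm, zero_mul, zero_mul]
        · simp
      · refine Finset.sum_congr rfl fun x _ => ?_
        rw [mul_assoc _ (E i 0 x), e3 _ _ _ _ _ _ (Ne.symm hij), mul_zero, ← mul_assoc,
          ← mul_assoc, e3 _ _ _ _ _ _ hij, zero_mul, zero_mul]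
  have lT : ∀ i n a, E i 0 a * T i n = E i 0 0 * n * E i 0 a := by
    intro i n a
    simp only [T, Finset.mul_sum]
    rw [Finset.sum_eq_single a]
    · rw [← mul_assoc, ← mul_assoc, e1]
    · intro x _ hx
      rw [← mul_assoc, ← mul_assoc, e2 _ _ _ _ _ hx.symm, zero_mul, zero_mul]
    · simp
  have rT : ∀ i n a, T i n * E i a 0 = E i a 0 * n * E i 0 0 := by
    intro i n a
    simp only [T, Finset.sum_mul]
    rw [Finset.sum_eq_single a]
    · rw [mul_assoc _ (E i 0 a), e1]
    · intro x _ hx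
      rw [mul_assoc _ (E i 0 x), e2 _ _ _ _ _ hx, mul_zero]
    · simp
  have hcor : ∀ i a b, ∃ μ : ℂ, E i 0 a * c * E i b 0 = μ • E i 0 0 := by
    intro i a b
    refine corner1 hω hP hNM hirr (hAN (mE i 0 0)) (e1 i 0 0 0)
      (mul_mem (mul_mem (hNM (hAN (mE i 0 a))) hc) (hNM (hAN (mE i b 0)))) ?_ ?_
    · rw [mul_assoc, e1]
    · intro n hn
      calc E i 0 a * c * E i b 0 * (n * E i 0 0) = E i 0 a * c * (E i b 0 * n * E i 0 0) := by
            simp only [mul_assoc]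
        _ = E i 0 a * (c * T i n) * E i b 0 := by rw [← rT]; simp only [mul_assoc]
        _ = E i 0 a * T i n * (c * E i b 0) := by rw [← cT i n hn]; simp only [mul_assoc]
        _ = _ := by rw [lT]; simp only [mul_assoc]
  have T1 : ∀ i, T i 1 = ∑ a, E i a a := fun i => by simp [T, e1]
  have hzz : ∀ i, T i 1 * T i 1 = T i 1 := by
    intro i
    conv_lhs => rw [T1]
    rw [Finset.sum_mul, T1]
    refine Finset.sum_congr rfl fun a _ => ?_
    rw [Finset.mul_sum, Finset.sum_eq_single a]
    · exact e1 _ _ _ _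
    · intro b _ hb
      exact e2 _ _ _ _ _ hb.symm
    · simp
  have hsum : c = ∑ i, T i 1 * c * T i 1 := by
    calc c = (∑ i, T i 1) * c := by simp only [T1, e4, one_mul]
      _ = _ := by
        rw [Finset.sum_mul]
        refine Finset.sum_congr rfl fun i _ => ?_
        rw [mul_assoc, ← cT i 1 (one_mem N), ← mul_assoc, hzz]
  rw [hsum]
  refine sum_mem fun i _ => ?_
  simp only [T, Finset.sum_mul, Finset.mul_sum, mul_one]
  refine sum_mem fun a _ => sum_mem fun b _ => ?_
  have : ∀ a b, E i a 0 * E i 0 a * c * (E i b 0 * E i 0 b) ∈ A := by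
    intro a b
    obtain ⟨μ, h⟩ := hcor i a b
    have : E i a 0 * E i 0 a * c * (E i b 0 * E i 0 b)
      = E i a 0 * (E i 0 a * c * E i b 0) * E i 0 b := by simp only [mul_assoc]
    rw [this, h]
    exact mul_mem (mul_mem (mE _ _ _) (A.smul_mem (mE _ _ _) μ)) (mE _ _ _)
  exact this _ _

end part7

section part8
variable {ω : Ultrafilter ℕ} {M Mω N W : VonNeumannAlgebra H} {τ : Op H →ₗ[ℂ] ℂ}
  {limω : (ℕ → Op H) → Op H}

lemma good_c (hω : IsFreeUltrafilter ω) (hP : IsTracialUltrapower ω M Mω τ limω)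
    (hNM : (N : Set (Op H)) ⊆ M) (hirr : relComm (N : Set (Op H)) (M : Set (Op H)) = scalars H)
    (A : StarSubalgebra ℂ (Op H)) (hA : FinDim (A : Set (Op H))) (hAN : (A : Set (Op H)) ⊆ N)
    {y : Op H} (hy : y ∈ M) {ε : ℝ}
    (hε : ∀ u ∈ UU N (A : Set (Op H)), q τ (u * y - y * u) ≤ ε) :
    ∃ c ∈ A, ‖c‖ ≤ ‖y‖ ∧ q τ (y - c) ≤ 2 * ε := by
  have hG : UGrp M (UU N (A : Set (Op H))) := UU_grp hNM _
  have hτ : IsTracialState (M : Set (Op H)) τ := hP.traceState.mono hP.subset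
  obtain ⟨Φ, hΦ, c, cM, cn, hc, ht⟩ := avg hω hP hG hy
  refine ⟨c, bicomm hω hP hNM hirr A hA hAN cM hc, cn, ?_⟩
  have h1 : ∀ F ∈ Av (UU N (A : Set (Op H))), F y ∈ M ∧ q τ (y - F y) ≤ ε := by
    intro F hF
    refine Av_ind (P := fun F => F y ∈ M ∧ q τ (y - F y) ≤ ε) ?_ ?_ hF
    · intro u hu
      have um : u ∈ M := hNM hu.1
      have hcm : u * y - y * u ∈ M := sub_mem (mul_mem um hy) (mul_mem hy um)
      refine ⟨by rw [Ad_apply]; exact mul_mem (mul_mem um hy) (star_mem um), ?_⟩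
      have e : Ad u y - y = (u * y - y * u) * star u := by
        rw [Ad_apply, sub_mul, mul_assoc y, hu.2.2.2, mul_one]
      rw [q_sub_comm, e]
      refine (q_mul_right hτ (star_mem um) hcm).trans ?_
      have n1 : ‖star u‖ ≤ 1 := by rw [norm_star]; exact u_norm hu.2.2.1
      have n2 : ‖star u‖ ^ 2 ≤ 1 := pow_le_one₀ (norm_nonneg _) n1
      have := q_nonneg hτ hcm
      nlinarith [hε u hu]
    · rintro F G ⟨m1, h1⟩ ⟨m2, h2⟩ a b ha hb hab
      refine ⟨add_mem (vrsmul a m1) (vrsmul b m2), ?_⟩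
      have e : y - (a • F + b • G) y = a • (y - F y) + b • (y - G y) := by
        have : y = (a + b) • y := by rw [hab, one_smul]
        calc y - (a • F + b • G) y = (a + b) • y - (a • F y + b • G y) := by rw [← this]; rfl
          _ = _ := by rw [add_smul, smul_sub, smul_sub]; abel
      rw [e]
      refine (q_convex hτ (sub_mem hy m1) (sub_mem hy m2) ha hb hab).trans ?_
      calc a * q τ (y - F y) + b * q τ (y - G y) ≤ a * ε + b * ε :=
            add_le_add (mul_le_mul_of_nonneg_left h1 ha) (mul_le_mul_of_nonneg_left h2 hb)
        _ = ε := by rw [← add_mul, hab, one_mul]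
  have h2 : Tendsto (fun l => 2 * ε + 2 * q τ (c - Φ l y)) atTop (nhds (2 * ε + 2 * 0)) :=
    (ht.const_mul 2).const_add _
  rw [mul_zero, add_zero] at h2
  refine ge_of_tendsto' h2 fun l => ?_
  have h3 := q_tri hτ hy (h1 _ (hΦ l)).1 cM
  have h4 := (h1 _ (hΦ l)).2
  rw [q_sub_comm c]
  linarith

lemma unif (hω : IsFreeUltrafilter ω) (hP : IsTracialUltrapower ω M Mω τ limω)
    (hNM : (N : Set (Op H)) ⊆ M) (A : ℕ → StarSubalgebra ℂ (Op H)) (hmono : Monotone A)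
    (hcc : Set.centralizer (Set.centralizer (⋃ n, (A n : Set (Op H)))) = (N : Set (Op H)))
    {xs : ℕ → Op H} (hx : SeqIn (M : Set (Op H)) xs) (bx : Bdd xs)
    (hcomm : ∀ y ∈ relComm (N : Set (Op H)) (ultrapowerSet limω (N : Set (Op H))),
      y * limω xs = limω xs * y) {ε : ℝ} (hε : 0 < ε) :
    ∃ k, ∀ᶠ n in (ω : Filter ℕ), ∀ u ∈ UU N (A k : Set (Op H)),
      q τ (u * xs n - xs n * u) ≤ ε := by
  classical
  by_contra! h
  let Q : ℕ → ℕ → Prop := fun n k => ∃ u ∈ UU N (A k : Set (Op H)), ε < q τ (u * xs n - xs n * u)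
  have hQ : ∀ k, ∀ᶠ n in (ω : Filter ℕ), Q n k := by
    intro k
    exact h k
  let κ : ℕ → ℕ := fun n => Nat.findGreatest (Q n) n
  have hκ : ∀ k, ∀ᶠ n in (ω : Filter ℕ), k ≤ κ n ∧ Q n (κ n) := by
    intro k
    filter_upwards [hQ k, ev_ge hω k] with n h1 h2
    exact ⟨Nat.le_findGreatest h2 h1, Nat.findGreatest_spec h2 h1⟩
  have hu : ∀ n, ∃ u ∈ UU N (A (κ n) : Set (Op H)), Q n (κ n) → ε < q τ (u * xs n - xs n * u) := by
    intro n
    by_cases hq : Q n (κ n)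
    · obtain ⟨u, h1, h2⟩ := hq
      exact ⟨u, h1, fun _ => h2⟩
    · exact ⟨1, (UU_grp (N := N) (M := N) subset_rfl _).one, fun h => absurd h hq⟩
  choose u hu hu2 using hu
  have uN : SeqIn (N : Set (Op H)) u := fun n => (hu n).1
  have uM : SeqIn (M : Set (Op H)) u := fun n => hNM (uN n)
  have bu : Bdd u := ⟨1, fun n => u_norm (hu n).2.2.1⟩
  have hN' : ∀ y ∈ (N : Set (Op H)), y * limω u = limω u * y := by
    intro y hy
    rw [← hcc] at hy
    refine (hy (limω u) ?_).symm
    intro a ha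
    obtain ⟨k, hk⟩ := Set.mem_iUnion.1 ha
    have aN : a ∈ N := by
      change a ∈ (N : Set (Op H))
      rw [← hcc]
      exact Set.subset_centralizer_centralizer ha
    have aM : a ∈ M := hNM aN
    have e : limω (fun n => a * u n) = limω (fun n => u n * a) := by
      refine lim_congr hP (fun n => mul_mem aM (uM n)) ((Bdd.const a).mul bu)
        (fun n => mul_mem (uM n) aM) (bu.mul (Bdd.const a)) ?_
      filter_upwards [hκ k] with n hn
      exact (hu n).2.1 a (hmono hn.1 hk)
    rw [hP.map_mul _ u (fun _ => aM) (Bdd.const a) uM bu,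
      hP.map_mul u _ uM bu (fun _ => aM) (Bdd.const a), hP.diag a aM] at e
    exact e
  have hcm := hcomm (limω u) ⟨⟨u, uN, bu, rfl⟩, hN'⟩
  have s1 : SeqIn (M : Set (Op H)) (fun n => u n * xs n) := fun n => mul_mem (uM n) (hx n)
  have s2 : SeqIn (M : Set (Op H)) (fun n => xs n * u n) := fun n => mul_mem (hx n) (uM n)
  have ht := q_lim hP (x := fun n => u n * xs n - xs n * u n) (fun n => sub_mem (s1 n) (s2 n))
    ((bu.mul bx).sub (bx.mul bu))
  rw [lim_sub hP s1 (bu.mul bx) s2 (bx.mul bu), hP.map_mul u xs uM bu hx bx,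
    hP.map_mul xs u hx bx uM bu, hcm, sub_self] at ht
  have h0 : q τ (0 : Op H) = 0 := by simp [q]
  rw [h0] at ht
  have : ε ≤ 0 := by
    refine ge_of_tendsto ht ?_
    filter_upwards [hκ 0] with n hn
    exact (hu2 n hn.2).le
  linarith

lemma approx (hω : IsFreeUltrafilter ω) (hP : IsTracialUltrapower ω M Mω τ limω)
    (hNM : (N : Set (Op H)) ⊆ M) (hirr : relComm (N : Set (Op H)) (M : Set (Op H)) = scalars H)
    (A : StarSubalgebra ℂ (Op H)) (hA : FinDim (A : Set (Op H))) (hAN : (A : Set (Op H)) ⊆ N)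
    {xs : ℕ → Op H} (hx : SeqIn (M : Set (Op H)) xs) {C : ℝ} (bx : ∀ n, ‖xs n‖ ≤ C) {ε : ℝ}
    (hε : ∀ᶠ n in (ω : Filter ℕ), ∀ u ∈ UU N (A : Set (Op H)), q τ (u * xs n - xs n * u) ≤ ε) :
    ∃ b ∈ N, ‖b‖ ≤ C ∧ q τ (limω xs - b) ≤ 2 * ε := by
  have hτ : IsTracialState (M : Set (Op H)) τ := hP.traceState.mono hP.subset
  have C0 : 0 ≤ C := (norm_nonneg _).trans (bx 0)
  let V : Submodule ℂ (Op H) := Subalgebra.toSubmodule A.toSubalgebra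
  have : FiniteDimensional ℂ V := fd A hA
  have : ProperSpace V := FiniteDimensional.proper ℂ V
  have hc : ∀ n, ∃ c : V, ‖c‖ ≤ C ∧ ((∀ u ∈ UU N (A : Set (Op H)), q τ (u * xs n - xs n * u) ≤ ε) →
      q τ (xs n - c) ≤ 2 * ε) := by
    intro n
    by_cases h : ∀ u ∈ UU N (A : Set (Op H)), q τ (u * xs n - xs n * u) ≤ ε
    · obtain ⟨c, h1, h2, h3⟩ := good_c hω hP hNM hirr A hA hAN (hx n) h
      exact ⟨⟨c, h1⟩, h2.trans (bx n), fun _ => h3⟩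
    · exact ⟨0, by simpa using C0, fun h' => absurd h' h⟩
  choose c hcn hcq using hc
  obtain ⟨b, hb⟩ := ultra_lim_exists ω c C hcn
  have cM : SeqIn (M : Set (Op H)) (fun n => (c n : Op H)) := fun n => hNM (hAN (c n).2)
  have bc : Bdd (fun n => (c n : Op H)) := ⟨C, hcn⟩
  have bN : (b : Op H) ∈ N := hAN b.2
  have bM : (b : Op H) ∈ M := hNM bN
  have hlim : limω (fun n => (c n : Op H)) = b := by
    rw [← hP.diag _ bM]
    refine lim_eq_of_q hP cM bc (fun _ => bM) (Bdd.const _) ?_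
    have h1 : Tendsto (fun n => ‖c n - b‖ ^ 2) (ω : Filter ℕ) (nhds 0) := by
      simpa using (tendsto_iff_norm_sub_tendsto_zero.1 hb).pow 2
    exact squeeze_zero (fun n => q_nonneg hτ (sub_mem (cM n) bM))
      (fun n => q_le_norm hτ (sub_mem (cM n) bM)) h1
  refine ⟨b, bN, ?_, ?_⟩
  · rw [← hlim]; exact lim_norm hP cM hcn
  · have ht := q_lim hP (x := fun n => xs n - c n) (fun n => sub_mem (hx n) (cM n))
      (Bdd.sub ⟨C, bx⟩ bc)
    rw [lim_sub hP hx ⟨C, bx⟩ cM bc, hlim] at ht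
    refine le_of_tendsto ht ?_
    filter_upwards [hε] with n hn
    exact hcq n hn

lemma main_sub (hω : IsFreeUltrafilter ω) (hP : IsTracialUltrapower ω M Mω τ limω)
    (hNM : (N : Set (Op H)) ⊆ M) (hirr : relComm (N : Set (Op H)) (M : Set (Op H)) = scalars H)
    (hf : IsHyperfinite N) :
    relComm (relComm (N : Set (Op H)) (ultrapowerSet limω (N : Set (Op H))))
        (Mω : Set (Op H)) = (N : Set (Op H)) := by
  apply Set.Subset.antisymm
  · rintro x ⟨xm, hxc⟩
    obtain ⟨A, hmono, hAN, hfd, hcc⟩ := hf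
    obtain ⟨xs, hx, ⟨C, bx⟩, rfl⟩ := hP.surj x xm
    have h1 : ∀ j : ℕ, ∃ b ∈ N, ‖b‖ ≤ C ∧ q τ (limω xs - b) ≤ 2 * (1 / ((j : ℝ) + 1)) := by
      intro j
      obtain ⟨k, hk⟩ := unif hω hP hNM A hmono hcc hx ⟨C, bx⟩ hxc
        (Nat.one_div_pos_of_nat (n := j) (α := ℝ))
      exact approx hω hP hNM hirr (A k) (hfd k) (hAN k) hx bx hk
    choose b bN bn bq using h1
    refine mem_of_comm fun T hT => ?_
    refine lemmaS hω hP xm (c := b) (fun j => hNM (bN j)) ⟨C, bn⟩ ?_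
      (fun j => (hT _ (bN j)).symm)
    refine squeeze_zero (fun j => q_nonneg hP.traceState
      (sub_mem xm (hP.subset (hNM (bN j))))) bq ?_
    simpa using (tendsto_one_div_add_atTop_nhds_zero_nat (𝕜 := ℝ)).const_mul 2
  · intro x hx
    exact ⟨hP.subset (hNM hx), fun y hy => (hy.2 x hx).symm⟩

end part8

/-- consequences of Ocneanu's central freedom lemma. Let `N ⊆ M`
be hyperfinite II₁ factors with `N' ∩ M = ℂ1`, `ω` a free ultrafilter on ℕ and
`M' ∩ M^ω ⊆ N^ω`. Then `(M' ∩ M^ω)' ∩ M^ω = M`, `(N' ∩ N^ω)' ∩ M^ω = N` and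
`(M' ∩ M^ω)' ∩ (N' ∩ M^ω) = ℂ1`. -/
theorem central_freedom_consequences
    {H : Type u} [NormedAddCommGroup H] [InnerProductSpace ℂ H] [CompleteSpace H]
    (ω : Ultrafilter ℕ) (hω : IsFreeUltrafilter ω)
    (M N Mω : VonNeumannAlgebra H) (τ : Op H →ₗ[ℂ] ℂ) (limω : (ℕ → Op H) → Op H)
    (hM : IsII1Factor M τ) (hN : IsII1Factor N τ)
    (hMhf : IsHyperfinite M) (hNhf : IsHyperfinite N)
    (hNM : (N : Set (Op H)) ⊆ (M : Set (Op H)))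
    (hirr : relComm (N : Set (Op H)) (M : Set (Op H)) = scalars H)
    (hU : IsTracialUltrapower ω M Mω τ limω)
    (hcs : relComm (M : Set (Op H)) (Mω : Set (Op H)) ⊆
      ultrapowerSet limω (N : Set (Op H))) :
    relComm (relComm (M : Set (Op H)) (Mω : Set (Op H))) (Mω : Set (Op H)) =
      (M : Set (Op H)) ∧
    relComm (relComm (N : Set (Op H)) (ultrapowerSet limω (N : Set (Op H))))
        (Mω : Set (Op H)) = (N : Set (Op H)) ∧
    relComm (relComm (M : Set (Op H)) (Mω : Set (Op H)))
        (relComm (N : Set (Op H)) (Mω : Set (Op H))) = scalars H := by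
  have hup : ultrapowerSet limω (M : Set (Op H)) = (Mω : Set (Op H)) := by
    ext z
    constructor
    · rintro ⟨x, h1, h2, rfl⟩
      exact hU.mem x h1 h2
    · exact hU.surj z
  have c1 := main_sub hω hU subset_rfl hM.factor hMhf
  rw [hup] at c1
  refine ⟨c1, main_sub hω hU hNM hirr hNhf, ?_⟩
  rw [← hirr]
  ext x
  constructor
  · rintro ⟨⟨h1, h2⟩, h3⟩
    have : x ∈ (M : Set (Op H)) := by
      rw [← c1]
      exact ⟨h1, h3⟩
    exact ⟨this, h2⟩
  · rintro ⟨h1, h2⟩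
    exact ⟨⟨hU.subset h1, h2⟩, fun y hy => (hy.2 x h1).symm⟩

end PopaQ
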